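/- arXiv:1002.1126 — 3 statements merged into one kernel-verified Lean document; each statement's English description precedes it below -/
import Mathlib

section
/- Let n ≥ 2 and T > 0. There exists a constant C > 0 such that for every finitely supported family of complex numbers (c_k)_{k ∈ ℕ^n}: Σ_k |c_k|² ≤ C ∫₀^T ∫_{(0,π)^{n−1}} | Σ_{k ∈ ℕ^n} c_k e^{−i|k|²t} ∏_{j=2}^n cos(k_j x_j) |² dx₂⋯dx_n dt, where |k|² = k₁²+⋯+k_n². -/
open MeasureTheory
open scoped ComplexConjugate

lemma norm_exp_neg_I_mul_mul (μ t : ℝ) : ‖Complex.exp (-Complex.I * μ * t)‖ = 1 := by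
  rw [Complex.norm_exp]; simp

lemma norm_integral_exp_sub_le (T : ℝ) (m l : ℕ) :
    ‖(∫ t in (0:ℝ)..T, Complex.exp (-Complex.I * (((m:ℝ) ^ 2 - (l:ℝ) ^ 2 : ℝ) : ℂ) * t)) -
      if m = l then (T : ℂ) else 0‖ ≤ 2 * |(m:ℝ) ^ 2 - (l:ℝ) ^ 2|⁻¹ := by
  by_cases h : m = l
  · subst h; simp
  · have h0 : (m:ℝ) ^ 2 - (l:ℝ) ^ 2 ≠ 0 := by
      rw [sub_ne_zero]
      intro h'
      exact h (by exact_mod_cast (pow_left_inj₀ (by positivity) (by positivity) two_ne_zero).1 h')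
    generalize (m:ℝ) ^ 2 - (l:ℝ) ^ 2 = μ at h0
    have h1 : -Complex.I * (μ : ℂ) ≠ 0 := by simp [h0]
    rw [if_neg h, sub_zero, integral_exp_mul_complex h1, norm_div, div_eq_mul_inv]
    have h2 : ‖-Complex.I * (μ : ℂ)‖ = |μ| := by simp
    rw [h2]
    gcongr
    refine (norm_sub_le _ _).trans ?_
    rw [norm_exp_neg_I_mul_mul, norm_exp_neg_I_mul_mul]; norm_num

lemma ofReal_integral_norm_sq_sum (T : ℝ) (s : Finset ℕ) (a : ℕ → ℂ) :
    ((∫ t in (0:ℝ)..T,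
      ‖∑ m ∈ s, a m * Complex.exp (-Complex.I * (((m:ℝ) ^ 2 : ℝ) : ℂ) * t)‖ ^ 2 : ℝ) : ℂ) =
    ∑ p ∈ s ×ˢ s, a p.1 * conj (a p.2) * ∫ t in (0:ℝ)..T,
      Complex.exp (-Complex.I * (((p.1:ℝ) ^ 2 - (p.2:ℝ) ^ 2 : ℝ) : ℂ) * t) := by
  rw [← intervalIntegral.integral_ofReal]
  simp_rw [← intervalIntegral.integral_const_mul]
  rw [← intervalIntegral.integral_finsetSum]
  · congr 1; ext t
    rw [Complex.ofReal_pow, ← Complex.mul_conj', map_sum, Finset.sum_mul_sum, Finset.sum_product]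
    refine Finset.sum_congr rfl fun m _ => Finset.sum_congr rfl fun l _ => ?_
    rw [map_mul, ← Complex.exp_conj, mul_mul_mul_comm, ← Complex.exp_add]
    congr 2
    simp
    ring
  · intro p _
    apply Continuous.intervalIntegrable
    fun_prop

lemma abs_integral_norm_sq_sum_sub_le (T : ℝ) (s : Finset ℕ) (a : ℕ → ℂ) :
    |(∫ t in (0:ℝ)..T,
      ‖∑ m ∈ s, a m * Complex.exp (-Complex.I * (((m:ℝ) ^ 2 : ℝ) : ℂ) * t)‖ ^ 2) -
        T * ∑ m ∈ s, ‖a m‖ ^ 2| ≤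
    2 * √(∑ p ∈ s ×ˢ s, (|(p.1:ℝ) ^ 2 - (p.2:ℝ) ^ 2|⁻¹) ^ 2) * ∑ m ∈ s, ‖a m‖ ^ 2 := by
  have hd : ((T * ∑ m ∈ s, ‖a m‖ ^ 2 : ℝ) : ℂ) =
      ∑ p ∈ s ×ˢ s, a p.1 * conj (a p.2) * if p.1 = p.2 then (T : ℂ) else 0 := by
    rw [Finset.sum_product, Complex.ofReal_mul, Complex.ofReal_sum, Finset.mul_sum]
    refine Finset.sum_congr rfl fun m hm => ?_
    simp [hm, Complex.mul_conj', mul_comm]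
  rw [← Real.norm_eq_abs, ← Complex.norm_real, Complex.ofReal_sub, ofReal_integral_norm_sq_sum, hd,
    ← Finset.sum_sub_distrib]
  simp_rw [← mul_sub]
  refine (norm_sum_le _ _).trans ?_
  calc _ ≤ ∑ p ∈ s ×ˢ s, (‖a p.1‖ * ‖a p.2‖) * (2 * |(p.1:ℝ) ^ 2 - (p.2:ℝ) ^ 2|⁻¹) := by
        refine Finset.sum_le_sum fun p _ => ?_
        rw [norm_mul, norm_mul, Complex.norm_conj]
        gcongr
        exact norm_integral_exp_sub_le T p.1 p.2
    _ = 2 * ∑ p ∈ s ×ˢ s, (‖a p.1‖ * ‖a p.2‖) * |(p.1:ℝ) ^ 2 - (p.2:ℝ) ^ 2|⁻¹ := by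
        rw [Finset.mul_sum]; exact Finset.sum_congr rfl fun p _ => by ring
    _ ≤ 2 * (√(∑ p ∈ s ×ˢ s, (‖a p.1‖ * ‖a p.2‖) ^ 2) *
          √(∑ p ∈ s ×ˢ s, (|(p.1:ℝ) ^ 2 - (p.2:ℝ) ^ 2|⁻¹) ^ 2)) := by
        gcongr
        exact Real.sum_mul_le_sqrt_mul_sqrt _ _ _
    _ = _ := by
        have : ∑ p ∈ s ×ˢ s, (‖a p.1‖ * ‖a p.2‖) ^ 2 = (∑ m ∈ s, ‖a m‖ ^ 2) ^ 2 := by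
          rw [sq (∑ m ∈ s, ‖a m‖ ^ 2), Finset.sum_mul_sum, Finset.sum_product]
          simp_rw [mul_pow]
        rw [this, Real.sqrt_sq (Finset.sum_nonneg fun _ _ => by positivity)]
        ring

lemma summable_inv_sq_sub_sq_sq :
    Summable fun p : ℕ × ℕ => (|(p.1:ℝ) ^ 2 - (p.2:ℝ) ^ 2|⁻¹) ^ 2 := by
  have h : Summable fun d : ℤ => 1 / (d:ℝ) ^ 2 :=
    Real.summable_one_div_int_pow.2 one_lt_two
  have h2 := h.mul_of_nonneg h (fun _ => by positivity) (fun _ => by positivity)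
  have hi : Function.Injective fun p : ℕ × ℕ => ((p.1:ℤ) - p.2, (p.1:ℤ) + p.2) := by
    rintro ⟨m, l⟩ ⟨m', l'⟩ h
    simp only [Prod.mk.injEq] at h ⊢
    omega
  refine (h2.comp_injective hi).congr fun p => ?_
  simp only [Function.comp, inv_pow, sq_abs]
  push_cast
  rw [← one_div, div_mul_div_comm, ← mul_pow, one_mul]
  ring_nf

lemma exists_tail_sum_lt (ε : ℝ) (hε : 0 < ε) : ∃ N : ℕ, ∀ s : Finset ℕ, (∀ m ∈ s, N ≤ m) →
    ∑ p ∈ s ×ˢ s, (|(p.1:ℝ) ^ 2 - (p.2:ℝ) ^ 2|⁻¹) ^ 2 < ε := by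
  obtain ⟨S, hS⟩ := summable_iff_vanishing_norm.1 summable_inv_sq_sub_sq_sq ε hε
  refine ⟨S.sup Prod.fst + 1, fun s hs => (le_abs_self _).trans_lt (hS _ ?_)⟩
  rw [Finset.disjoint_left]
  intro p hp hp'
  have h1 := hs _ (Finset.mem_product.1 hp).1
  have h2 := Finset.le_sup (f := Prod.fst) hp'
  omega

lemma one_sub_sinc_lower (δ : ℝ) (hδ : 0 < δ) :
    ∃ c > 0, ∀ x : ℝ, δ ≤ x → c * x ≤ x - Real.sin x := by
  obtain ⟨y, hy, hmin⟩ := (isCompact_Icc (a := δ) (b := max δ 2)).exists_isMinOn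
    (Set.nonempty_Icc.2 (le_max_left _ _))
    (f := fun x => x - Real.sin x) (by fun_prop)
  have hy0 : 0 < y - Real.sin y := sub_pos.2 (Real.sin_lt (hδ.trans_le hy.1))
  have hM : 0 < max δ 2 := lt_max_of_lt_left hδ
  refine ⟨min (1/2) ((y - Real.sin y) / max δ 2), by positivity, fun x hx => ?_⟩
  have hx0 := hδ.trans_le hx
  rcases le_total x (max δ 2) with h | h
  · calc _ ≤ ((y - Real.sin y) / max δ 2) * max δ 2 := by
          gcongr; exact min_le_right _ _
      _ = y - Real.sin y := by field_simp
      _ ≤ _ := hmin ⟨hx, h⟩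
  · have h2 : 2 ≤ x := (le_max_right _ _).trans h
    have := Real.sin_le_one x
    have : min (1/2) ((y - Real.sin y) / max δ 2) * x ≤ 1/2 * x := by
      gcongr; exact min_le_left _ _
    linarith

lemma integral_norm_exp_sub_one_sq_lower (δ : ℝ) (hδ : 0 < δ) :
    ∃ c > 0, ∀ μ : ℤ, μ ≠ 0 →
      c ≤ ∫ r in (0:ℝ)..δ, ‖Complex.exp (-Complex.I * (μ : ℝ) * r) - 1‖ ^ 2 := by
  obtain ⟨c, hc, h⟩ := one_sub_sinc_lower δ hδ
  refine ⟨2 * (c * δ), by positivity, fun μ hμ => ?_⟩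
  have hμ' : (μ : ℝ) ≠ 0 := by exact_mod_cast hμ
  have e (r : ℝ) : ‖Complex.exp (-Complex.I * (μ : ℝ) * r) - 1‖ ^ 2 = 2 - 2 * Real.cos (μ * r) := by
    have : -Complex.I * (μ : ℝ) * r = ((-(μ * r) : ℝ) : ℂ) * Complex.I := by push_cast; ring
    rw [this, Complex.sq_norm, Complex.normSq_apply, Complex.sub_re, Complex.sub_im,
      Complex.exp_ofReal_mul_I_re, Complex.exp_ofReal_mul_I_im]
    simp
    nlinarith [Real.sin_sq_add_cos_sq (μ * r)]
  simp_rw [e]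
  rw [intervalIntegral.integral_sub (by simp) (by apply Continuous.intervalIntegrable; fun_prop),
    intervalIntegral.integral_const_mul, intervalIntegral.integral_comp_mul_left _ hμ']
  simp only [intervalIntegral.integral_const, integral_cos, smul_eq_mul, mul_zero, Real.sin_zero,
    sub_zero]
  have h1 : δ ≤ |(μ:ℝ)| * δ := by
    have : (1:ℝ) ≤ |(μ:ℝ)| := by exact_mod_cast Int.one_le_abs hμ
    nlinarith
  have h2 := h _ h1
  have h3 : (μ:ℝ)⁻¹ * Real.sin (μ * δ) = |(μ:ℝ)|⁻¹ * Real.sin (|(μ:ℝ)| * δ) := by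
    rcases abs_choice (μ:ℝ) with h | h <;> rw [h]
    simp
  rw [h3]
  have h4 : 0 < |(μ:ℝ)| := abs_pos.2 hμ'
  have h5 : c * δ ≤ δ - |(μ:ℝ)|⁻¹ * Real.sin (|(μ:ℝ)| * δ) := by
    calc c * δ = |(μ:ℝ)|⁻¹ * (c * (|(μ:ℝ)| * δ)) := by field_simp
      _ ≤ |(μ:ℝ)|⁻¹ * (|(μ:ℝ)| * δ - Real.sin (|(μ:ℝ)| * δ)) := by gcongr
      _ = _ := by field_simp
  linarith

/-- Observability on `(0, T)` of nonharmonic series with frequencies `m ^ 2`, `m ≥ N`. -/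
def SquareObservable (N : ℕ) (T : ℝ) : Prop :=
  ∃ C : ℝ, 0 < C ∧ ∀ s : Finset ℕ, (∀ m ∈ s, N ≤ m) → ∀ a : ℕ → ℂ,
    ∑ m ∈ s, ‖a m‖ ^ 2 ≤ C * ∫ t in (0:ℝ)..T,
      ‖∑ m ∈ s, a m * Complex.exp (-Complex.I * (((m:ℝ) ^ 2 : ℝ) : ℂ) * t)‖ ^ 2

lemma exists_squareObservable (T : ℝ) (hT : 0 < T) : ∃ N, SquareObservable N T := by
  obtain ⟨N, hN⟩ := exists_tail_sum_lt ((T / 4) ^ 2) (by positivity)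
  refine ⟨N, 2 / T, by positivity, fun s hs a => ?_⟩
  have h1 := (abs_le.1 (abs_integral_norm_sq_sum_sub_le T s a)).1
  have h2 := Real.sqrt_le_sqrt (hN s hs).le
  rw [Real.sqrt_sq (by positivity)] at h2
  have h3 : 0 ≤ ∑ m ∈ s, ‖a m‖ ^ 2 := Finset.sum_nonneg fun _ _ => by positivity
  have h4 := mul_le_mul_of_nonneg_right h2 h3
  rw [div_mul_eq_mul_div, le_div_iff₀ hT]
  linarith

lemma exists_integral_norm_sq_sum_le (T : ℝ) (hT : 0 < T) :
    ∃ B : ℝ, 0 < B ∧ ∀ (s : Finset ℕ) (a : ℕ → ℂ), (∫ t in (0:ℝ)..T,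
      ‖∑ m ∈ s, a m * Complex.exp (-Complex.I * (((m:ℝ) ^ 2 : ℝ) : ℂ) * t)‖ ^ 2) ≤
        B * ∑ m ∈ s, ‖a m‖ ^ 2 := by
  refine ⟨T + 2 * √(∑' p : ℕ × ℕ, (|(p.1:ℝ) ^ 2 - (p.2:ℝ) ^ 2|⁻¹) ^ 2), by positivity,
    fun s a => ?_⟩
  have h1 := (abs_le.1 (abs_integral_norm_sq_sum_sub_le T s a)).2
  have h2 := Real.sqrt_le_sqrt
    (summable_inv_sq_sub_sq_sq.sum_le_tsum (s ×ˢ s) fun _ _ => by positivity)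
  have h3 : 0 ≤ ∑ m ∈ s, ‖a m‖ ^ 2 := Finset.sum_nonneg fun _ _ => by positivity
  have h4 := mul_le_mul_of_nonneg_right h2 h3
  linarith

lemma norm_sub_sq_le_two_mul {E : Type*} [SeminormedAddCommGroup E] (z w : E) :
    ‖z - w‖ ^ 2 ≤ 2 * ‖z‖ ^ 2 + 2 * ‖w‖ ^ 2 := by
  nlinarith [norm_sub_le z w, norm_nonneg (z - w), sq_nonneg (‖z‖ - ‖w‖)]

lemma integral_norm_sq_sub_le (T : ℝ) (hT : 0 ≤ T) {f g : ℝ → ℂ} (hf : Continuous f)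
    (hg : Continuous g) :
    (∫ t in (0:ℝ)..T, ‖f t - g t‖ ^ 2) ≤
      2 * (∫ t in (0:ℝ)..T, ‖f t‖ ^ 2) + 2 * ∫ t in (0:ℝ)..T, ‖g t‖ ^ 2 := by
  rw [← intervalIntegral.integral_const_mul, ← intervalIntegral.integral_const_mul,
    ← intervalIntegral.integral_add (by apply Continuous.intervalIntegrable; fun_prop)
      (by apply Continuous.intervalIntegrable; fun_prop)]
  exact intervalIntegral.integral_mono_on hT
    (by apply Continuous.intervalIntegrable; fun_prop)
    (by apply Continuous.intervalIntegrable; fun_prop) fun t _ => norm_sub_sq_le_two_mul _ _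

lemma integral_norm_shift_sub_sq_le {T T' r : ℝ} (hT : 0 < T) (hr : 0 ≤ r) (hrT : r + T ≤ T')
    {f : ℝ → ℂ} (hf : Continuous f) (z : ℂ) (hz : ‖z‖ = 1) :
    (∫ t in (0:ℝ)..T, ‖z * f (t + r) - f t‖ ^ 2) ≤ 4 * ∫ t in (0:ℝ)..T', ‖f t‖ ^ 2 := by
  have hi (a b : ℝ) : IntervalIntegrable (fun t => ‖f t‖ ^ 2) volume a b := by
    apply Continuous.intervalIntegrable; fun_prop
  have h := integral_norm_sq_sub_le T hT.le (f := fun t => z * f (t + r)) (g := f)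
    (by fun_prop) hf
  simp_rw [norm_mul, hz, one_mul] at h
  rw [intervalIntegral.integral_comp_add_right (fun t => ‖f t‖ ^ 2)] at h
  have h1 : (∫ t in (0 + r)..(T + r), ‖f t‖ ^ 2) ≤ ∫ t in (0:ℝ)..T', ‖f t‖ ^ 2 :=
    intervalIntegral.integral_mono_interval (by linarith) (by linarith) (by linarith)
      (Filter.Eventually.of_forall fun _ => by positivity) (hi _ _)
  have h2 : (∫ t in (0:ℝ)..T, ‖f t‖ ^ 2) ≤ ∫ t in (0:ℝ)..T', ‖f t‖ ^ 2 :=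
    intervalIntegral.integral_mono_interval le_rfl hT.le (by linarith)
      (Filter.Eventually.of_forall fun _ => by positivity) (hi _ _)
  linarith

/-- The frequency `N ^ 2` can be added at the cost of an arbitrarily small amount of time. -/
lemma SquareObservable.of_succ {N : ℕ} {T T' : ℝ} (hT : 0 < T) (hTT' : T < T')
    (h : SquareObservable (N + 1) T) : SquareObservable N T' := by
  obtain ⟨C, hC, hobs⟩ := h
  have hδ : 0 < T' - T := sub_pos.2 hTT'
  have hT' : 0 < T' := hT.trans hTT'
  obtain ⟨c, hc, hlow⟩ := integral_norm_exp_sub_one_sq_lower (T' - T) hδ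
  obtain ⟨B, hB, hup⟩ := exists_integral_norm_sq_sum_le T' hT'
  set D := 4 * C * (T' - T) / c with hD
  have hD0 : 0 < D := by positivity
  refine ⟨2 / T' * (1 + B * D) + D, by positivity, fun s hs a => ?_⟩
  set f : ℝ → ℂ := fun t => ∑ m ∈ s, a m * Complex.exp (-Complex.I * (((m:ℝ) ^ 2 : ℝ) : ℂ) * t)
    with hf
  set g : ℝ → ℂ := fun t =>
    ∑ m ∈ s.erase N, a m * Complex.exp (-Complex.I * (((m:ℝ) ^ 2 : ℝ) : ℂ) * t) with hg
  have hfc : Continuous f := by fun_prop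
  have hgc : Continuous g := by fun_prop
  set J := ∫ t in (0:ℝ)..T', ‖f t‖ ^ 2 with hJ
  have hJ0 : 0 ≤ J := intervalIntegral.integral_nonneg hT'.le fun _ _ => by positivity
  change _ ≤ _ * J
  have hs' : ∀ m ∈ s.erase N, N + 1 ≤ m := fun m hm => by
    have := hs m (Finset.mem_of_mem_erase hm)
    have := Finset.ne_of_mem_erase hm
    omega
  have hshift (r : ℝ) (hr : r ∈ Set.Icc 0 (T' - T)) :
      ∑ m ∈ s.erase N, ‖a m‖ ^ 2 *
        ‖Complex.exp (-Complex.I * (((m:ℤ) ^ 2 - (N:ℤ) ^ 2 : ℤ) : ℝ) * r) - 1‖ ^ 2 ≤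
          4 * C * J := by
    have h1 := hobs (s.erase N) hs'
      fun m => a m * (Complex.exp (-Complex.I * (((m:ℤ) ^ 2 - (N:ℤ) ^ 2 : ℤ) : ℝ) * r) - 1)
    simp_rw [norm_mul, mul_pow] at h1
    refine h1.trans ?_
    rw [mul_comm 4 C, mul_assoc]
    refine mul_le_mul_of_nonneg_left ?_ hC.le
    refine le_trans (le_of_eq ?_) (integral_norm_shift_sub_sq_le hT hr.1 (by linarith [hr.2]) hfc
      (Complex.exp (Complex.I * (((N:ℝ) ^ 2 : ℝ) : ℂ) * r)) ?_)
    · congr 1; ext t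
      congr 2
      simp only [hf]
      rw [Finset.mul_sum, ← Finset.sum_sub_distrib, Finset.sum_erase]
      · refine Finset.sum_congr rfl fun m _ => ?_
        have : Complex.exp (Complex.I * (((N:ℝ) ^ 2 : ℝ) : ℂ) * r) *
            Complex.exp (-Complex.I * (((m:ℝ) ^ 2 : ℝ) : ℂ) * ((t + r : ℝ) : ℂ)) =
            Complex.exp (-Complex.I * (((m:ℤ) ^ 2 - (N:ℤ) ^ 2 : ℤ) : ℝ) * r) *
              Complex.exp (-Complex.I * (((m:ℝ) ^ 2 : ℝ) : ℂ) * t) := by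
          rw [← Complex.exp_add, ← Complex.exp_add]
          congr 1
          push_cast
          ring
        rw [mul_left_comm, this]
        ring
      · simp
    · rw [← neg_neg (Complex.I), neg_mul, neg_mul, Complex.exp_neg, norm_inv,
        norm_exp_neg_I_mul_mul, inv_one]
  have herase : ∑ m ∈ s.erase N, ‖a m‖ ^ 2 ≤ D * J := by
    have h1 : ∑ m ∈ s.erase N, ‖a m‖ ^ 2 * c ≤ (T' - T) * (4 * C * J) := by
      calc _ ≤ ∑ m ∈ s.erase N, ‖a m‖ ^ 2 * ∫ r in (0:ℝ)..(T' - T),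
            ‖Complex.exp (-Complex.I * (((m:ℤ) ^ 2 - (N:ℤ) ^ 2 : ℤ) : ℝ) * r) - 1‖ ^ 2 := by
            refine Finset.sum_le_sum fun m hm => ?_
            gcongr
            apply hlow
            have := hs' m hm
            have : (N:ℤ) < m := by exact_mod_cast this
            have : (N:ℤ) ^ 2 < (m:ℤ) ^ 2 := by gcongr
            omega
        _ = ∫ r in (0:ℝ)..(T' - T), ∑ m ∈ s.erase N, ‖a m‖ ^ 2 *
            ‖Complex.exp (-Complex.I * (((m:ℤ) ^ 2 - (N:ℤ) ^ 2 : ℤ) : ℝ) * r) - 1‖ ^ 2 := by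
            simp_rw [← intervalIntegral.integral_const_mul]
            rw [intervalIntegral.integral_finsetSum]
            intro m _
            apply Continuous.intervalIntegrable
            fun_prop
        _ ≤ ∫ r in (0:ℝ)..(T' - T), 4 * C * J :=
            intervalIntegral.integral_mono_on hδ.le
              (by apply Continuous.intervalIntegrable; fun_prop) (by simp) hshift
        _ = _ := by rw [intervalIntegral.integral_const, sub_zero, smul_eq_mul]
    rw [← Finset.sum_mul, ← le_div_iff₀ hc] at h1
    refine h1.trans (le_of_eq ?_)
    rw [hD]; ring
  by_cases hN : N ∈ s
  · have hlead : T' * ‖a N‖ ^ 2 ≤ 2 * J + 2 * (B * (D * J)) := by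
      calc T' * ‖a N‖ ^ 2 = ∫ t in (0:ℝ)..T', ‖f t - g t‖ ^ 2 := by
            have (t : ℝ) : ‖f t - g t‖ = ‖a N‖ := by
              simp only [hf, hg]
              rw [← Finset.add_sum_erase s _ hN, add_sub_cancel_right, norm_mul,
                norm_exp_neg_I_mul_mul, mul_one]
            simp [this]
        _ ≤ 2 * J + 2 * ∫ t in (0:ℝ)..T', ‖g t‖ ^ 2 := integral_norm_sq_sub_le T' hT'.le hfc hgc
        _ ≤ _ := by
            gcongr
            exact (hup _ _).trans (by gcongr)
    rw [← Finset.add_sum_erase s _ hN]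
    have : ‖a N‖ ^ 2 ≤ 2 / T' * (1 + B * D) * J := by
      rw [div_mul_eq_mul_div, div_mul_eq_mul_div, le_div_iff₀ hT']
      linarith
    linarith
  · rw [Finset.erase_eq_of_notMem hN] at herase
    have : 0 ≤ 2 / T' * (1 + B * D) * J := by positivity
    linarith

lemma SquareObservable.zero_of_lt (N : ℕ) : ∀ {T T' : ℝ}, 0 < T → T < T' →
    SquareObservable N T → SquareObservable 0 T' := by
  induction N with
  | zero =>
    rintro T T' hT hTT' ⟨C, hC, h⟩
    refine ⟨C, hC, fun s hs a => (h s hs a).trans ?_⟩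
    gcongr
    exact intervalIntegral.integral_mono_interval le_rfl hT.le hTT'.le
      (Filter.Eventually.of_forall fun _ => by positivity)
      (by apply Continuous.intervalIntegrable; fun_prop)
  | succ N ih =>
    intro T T' hT hTT' h
    obtain ⟨S, hS, hS'⟩ := exists_between hTT'
    exact ih (hT.trans hS) hS' (h.of_succ hT hS)

lemma squareObservable_zero {T : ℝ} (hT : 0 < T) : SquareObservable 0 T := by
  obtain ⟨N, hN⟩ := exists_squareObservable (T / 2) (by positivity)
  exact hN.zero_of_lt N (by positivity) (by linarith)

lemma integral_cos_int_mul (j : ℤ) :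
    ∫ x in Set.Ioo 0 Real.pi, Real.cos (j * x) = if j = 0 then Real.pi else 0 := by
  rw [← integral_Ioc_eq_integral_Ioo, ← intervalIntegral.integral_of_le Real.pi_pos.le]
  split_ifs with h
  · simp [h]
  · rw [intervalIntegral.integral_comp_mul_left _ (by exact_mod_cast h)]
    simp

lemma integral_cos_mul_cos (k l : ℕ) :
    ∫ x in Set.Ioo 0 Real.pi, Real.cos (k * x) * Real.cos (l * x) =
      ((if (k:ℤ) - l = 0 then Real.pi else 0) + if (k:ℤ) + l = 0 then Real.pi else 0) / 2 := by
  have hi (j : ℤ) : IntegrableOn (fun x : ℝ => Real.cos (j * x)) (Set.Ioo 0 Real.pi) :=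
    (Continuous.integrableOn_Icc (by fun_prop)).mono_set Set.Ioo_subset_Icc_self
  rw [← integral_cos_int_mul, ← integral_cos_int_mul, ← integral_add (hi _) (hi _),
    ← integral_div]
  congr 1; ext x
  push_cast
  rw [sub_mul, add_mul, Real.cos_sub, Real.cos_add]
  ring

lemma integral_cos_mul_cos_of_ne {k l : ℕ} (h : k ≠ l) :
    ∫ x in Set.Ioo 0 Real.pi, Real.cos (k * x) * Real.cos (l * x) = 0 := by
  rw [integral_cos_mul_cos, if_neg (by omega), if_neg (by omega)]
  simp

lemma one_le_integral_cos_mul_cos_self (k : ℕ) :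
    1 ≤ ∫ x in Set.Ioo 0 Real.pi, Real.cos (k * x) * Real.cos (k * x) := by
  rw [integral_cos_mul_cos, if_pos (by omega)]
  have := Real.two_le_pi
  split_ifs <;> linarith

lemma integral_box_prod_cos_mul_prod_cos {ι : Type*} [Fintype ι] (k l : ι → ℕ) :
    ∫ x in {x : ι → ℝ | ∀ i, x i ∈ Set.Ioo 0 Real.pi},
      (∏ i, Real.cos (k i * x i)) * ∏ i, Real.cos (l i * x i) =
    ∏ i, ∫ x in Set.Ioo 0 Real.pi, Real.cos (k i * x) * Real.cos (l i * x) := by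
  have hbox : {x : ι → ℝ | ∀ i, x i ∈ Set.Ioo 0 Real.pi} =
      Set.univ.pi fun _ => Set.Ioo 0 Real.pi := by ext; simp
  simp_rw [← Finset.prod_mul_distrib]
  rw [hbox, volume_pi, Measure.restrict_pi_pi]
  exact integral_fintype_prod_eq_prod (fun i x => Real.cos (k i * x) * Real.cos (l i * x))

/-- Orthogonality of the products of cosines on the box `(0, π) ^ ι`. -/
lemma exists_weight_integral_box_norm_sq (ι : Type*) [Fintype ι] :
    ∃ w : (ι → ℕ) → ℝ, (∀ k, 1 ≤ w k) ∧ ∀ (S : Finset (ι → ℕ)) (g : (ι → ℕ) → ℂ),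
      ∫ x in {x : ι → ℝ | ∀ i, x i ∈ Set.Ioo 0 Real.pi},
        ‖∑ k ∈ S, g k * ∏ i, (Real.cos (k i * x i) : ℂ)‖ ^ 2 = ∑ k ∈ S, w k * ‖g k‖ ^ 2 := by
  classical
  refine ⟨fun k => ∏ i, ∫ x in Set.Ioo 0 Real.pi, Real.cos (k i * x) * Real.cos (k i * x),
    fun k => Finset.one_le_prod fun i _ => one_le_integral_cos_mul_cos_self _, fun S g => ?_⟩
  rw [← Complex.ofReal_inj, ← integral_complex_ofReal]
  have hexp (x : ι → ℝ) : ((‖∑ k ∈ S, g k * ∏ i, (Real.cos (k i * x i) : ℂ)‖ ^ 2 : ℝ) : ℂ) =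
      ∑ k ∈ S, ∑ l ∈ S, g k * conj (g l) *
        (((∏ i, Real.cos (k i * x i)) * ∏ i, Real.cos (l i * x i) : ℝ) : ℂ) := by
    rw [Complex.ofReal_pow, ← Complex.mul_conj', map_sum, Finset.sum_mul_sum]
    refine Finset.sum_congr rfl fun k _ => Finset.sum_congr rfl fun l _ => ?_
    rw [map_mul, map_prod]
    simp only [Complex.conj_ofReal, Complex.ofReal_mul, Complex.ofReal_prod]
    ring
  have hi (k l : ι → ℕ) : IntegrableOn (fun x : ι → ℝ => g k * conj (g l) *
        (((∏ i, Real.cos (k i * x i)) * ∏ i, Real.cos (l i * x i) : ℝ) : ℂ))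
        {x : ι → ℝ | ∀ i, x i ∈ Set.Ioo 0 Real.pi} :=
    (Continuous.integrableOn_Icc (a := 0) (b := fun _ => Real.pi) (by fun_prop)).mono_set
      fun x hx => ⟨fun i => (hx i).1.le, fun i => (hx i).2.le⟩
  simp_rw [hexp]
  rw [integral_finsetSum _ fun k _ => integrable_finsetSum _ fun l _ => hi k l,
    Complex.ofReal_sum]
  refine Finset.sum_congr rfl fun k hk => ?_
  rw [integral_finsetSum _ fun l _ => hi k l, Finset.sum_eq_single_of_mem k hk]
  · rw [integral_const_mul, integral_complex_ofReal, integral_box_prod_cos_mul_prod_cos,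
      Complex.mul_conj']
    push_cast
    ring
  · intro l _ hlk
    obtain ⟨i, hne⟩ := Function.ne_iff.1 hlk
    rw [integral_const_mul, integral_complex_ofReal, integral_box_prod_cos_mul_prod_cos,
      Finset.prod_eq_zero (Finset.mem_univ i) (integral_cos_mul_cos_of_ne hne.symm)]
    simp

/-- A finitely supported sum over tuples as an iterated sum, separating the coordinate `i₀`. -/
lemma exists_finsupp_sum_eq_sum_sum {κ : Type*} [DecidableEq κ] (i₀ : κ) (c : (κ → ℕ) →₀ ℂ) :
    ∃ (s : Finset ℕ) (S : Finset ({i // i ≠ i₀} → ℕ)), ∀ {M : Type} [AddCommMonoid M]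
      (F : (κ → ℕ) → ℂ → M), (∀ k, F k 0 = 0) → c.sum F =
        ∑ k ∈ S, ∑ m ∈ s, F ((Equiv.funSplitAt i₀ ℕ).symm (m, k))
          (c ((Equiv.funSplitAt i₀ ℕ).symm (m, k))) := by
  classical
  set e := Equiv.funSplitAt i₀ ℕ
  refine ⟨c.support.image fun k => (e k).1, c.support.image fun k => (e k).2,
    fun F hF => ?_⟩
  rw [Finsupp.sum_of_support_subset c
    (s := ((c.support.image fun k => (e k).1) ×ˢ (c.support.image fun k => (e k).2)).map
      e.symm.toEmbedding) ?_ F fun k _ => hF k, Finset.sum_map,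
    Finset.sum_product_right]
  · rfl
  · intro k hk
    rw [Finset.mem_map_equiv, Equiv.symm_symm, Finset.mem_product]
    exact ⟨Finset.mem_image_of_mem (fun k => (e k).1) hk,
      Finset.mem_image_of_mem (fun k => (e k).2) hk⟩

/-- Boundary observability for the Neumann problem on a side of the cube:
`Σ_k |c_k|² ≤ C ∫₀ᵀ ∫_{(0,π)^{n−1}} |Σ_k c_k e^{−i|k|²t} ∏_{j≥2} cos(k_j x_j)|² dx' dt`. -/
theorem stmt1 (n : ℕ) (hn : 2 ≤ n) (T : ℝ) (hT : 0 < T) :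
    ∃ C : ℝ, 0 < C ∧ ∀ c : (Fin n → ℕ) →₀ ℂ,
      (c.sum fun _ a => ‖a‖ ^ 2) ≤
        C * ∫ t in Set.Ioc (0 : ℝ) T,
          ∫ x' in {x' : {i : Fin n // i ≠ ⟨0, by omega⟩} → ℝ |
              ∀ i, x' i ∈ Set.Ioo 0 Real.pi},
            ‖c.sum fun k a =>
              a * Complex.exp (-Complex.I * ((∑ j, ((k j : ℝ)) ^ 2 : ℝ) : ℂ) * (t : ℂ)) *
                ∏ i : {i : Fin n // i ≠ ⟨0, by omega⟩},
                  (Real.cos ((k i.1 : ℝ) * x' i) : ℂ)‖ ^ 2 := by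
  obtain ⟨C, hC, hobs⟩ := squareObservable_zero hT
  refine ⟨C, hC, fun c => ?_⟩
  set i₀ : Fin n := ⟨0, by omega⟩ with hi₀
  obtain ⟨s, S, hsum⟩ := exists_finsupp_sum_eq_sum_sum i₀ c
  obtain ⟨w, hw, hint⟩ := exists_weight_integral_box_norm_sq {i : Fin n // i ≠ i₀}
  set e := Equiv.funSplitAt i₀ ℕ with he
  set G : ({i : Fin n // i ≠ i₀} → ℕ) → ℝ → ℂ := fun k t =>
    ∑ m ∈ s, c (e.symm (m, k)) * Complex.exp (-Complex.I * (((m:ℝ) ^ 2 : ℝ) : ℂ) * t) with hG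
  set E : ({i : Fin n // i ≠ i₀} → ℕ) → ℝ → ℂ := fun k t =>
    Complex.exp (-Complex.I * ((∑ j, (k j : ℝ) ^ 2 : ℝ) : ℂ) * t) with hE
  have he₀ (m : ℕ) (k : {i : Fin n // i ≠ i₀} → ℕ) : e.symm (m, k) i₀ = m := by
    simp [he]
  have hne (m : ℕ) (k : {i : Fin n // i ≠ i₀} → ℕ) (i : {i : Fin n // i ≠ i₀}) :
      e.symm (m, k) i.1 = k i := by
    simp [he, i.2]
  have hsplit (t : ℝ) (x' : {i : Fin n // i ≠ i₀} → ℝ) :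
      (c.sum fun k a => a * Complex.exp (-Complex.I * ((∑ j, ((k j : ℝ)) ^ 2 : ℝ) : ℂ) * (t : ℂ)) *
        ∏ i : {i : Fin n // i ≠ i₀}, (Real.cos ((k i.1 : ℝ) * x' i) : ℂ)) =
      ∑ k ∈ S, (E k t * G k t) * ∏ i, (Real.cos (k i * x' i) : ℂ) := by
    rw [hsum _ fun k => by simp]
    refine Finset.sum_congr rfl fun k _ => ?_
    simp only [hE, hG, Finset.mul_sum, Finset.sum_mul]
    refine Finset.sum_congr rfl fun m _ => ?_
    simp only [hne]
    congr 1
    rw [mul_left_comm, ← Complex.exp_add, Fintype.sum_eq_add_sum_subtype_ne _ i₀]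
    simp only [hne, he₀]
    congr 2
    push_cast
    ring
  have hEnorm (k : {i : Fin n // i ≠ i₀} → ℕ) (t : ℝ) : ‖E k t‖ = 1 := norm_exp_neg_I_mul_mul _ _
  simp_rw [hsplit, hint, norm_mul, hEnorm, one_mul]
  rw [hsum _ fun k => by simp, ← intervalIntegral.integral_of_le hT.le,
    intervalIntegral.integral_finsetSum fun k _ => by
      apply Continuous.intervalIntegrable; fun_prop, Finset.mul_sum]
  refine Finset.sum_le_sum fun k _ => (hobs s (by simp) fun m => c (e.symm (m, k))).trans ?_
  rw [intervalIntegral.integral_const_mul]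
  gcongr
  exact le_mul_of_one_le_left
    (intervalIntegral.integral_nonneg hT.le fun _ _ => by positivity) (hw k)
end

section
/- Let n ≥ 1, T > 0 and let ω be a nonempty open subset of (0,π)^n. There exists a constant c > 0 such that for every finitely supported family of complex numbers (v_p)_{p ∈ (ℕ*)^n}, writing v(x,t) = Σ_p v_p e^{−i|p|²t} ∏_{j=1}^n sin(p_j x_j), one has Σ_p |p|² |v_p|² ≤ c · Σ_{j=1}^n ∫₀^T ∫_ω |∂v/∂x_j(x,t)|² dx dt. -/
open MeasureTheory

/-- `|p|² = p₁² + ⋯ + p_n²` for a tuple of positive integers. -/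
noncomputable def pnorm2 {n : ℕ} (p : Fin n → ℕ+) : ℝ := ∑ j, ((p j : ℝ)) ^ 2

/-- The partial derivative `∂v/∂x_j` of the explicit solution
`v(x,t) = Σ_p v_p e^{−i|p|²t} ∏_i sin(p_i x_i)`, namely
`Σ_p v_p e^{−i|p|²t} p_j cos(p_j x_j) ∏_{i ≠ j} sin(p_i x_i)`. -/
noncomputable def dV {n : ℕ} (v : (Fin n → ℕ+) →₀ ℂ) (j : Fin n)
    (x : Fin n → ℝ) (t : ℝ) : ℂ :=
  v.sum fun p c =>
    c * Complex.exp (-Complex.I * (pnorm2 p : ℂ) * (t : ℂ)) *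
      ((p j : ℝ) : ℂ) * (Real.cos ((p j : ℝ) * x j) : ℂ) *
      ∏ i ∈ Finset.univ.erase j, (Real.sin ((p i : ℝ) * x i) : ℂ)

/-- The sesquilinear form `∑ k l, A k l * a k * conj (a l)` over a finite index set. -/
noncomputable def quadForm {G : Type*} (A : G → G → ℂ) (s : Finset G) (a : G → ℂ) : ℂ :=
  ∑ k ∈ s, ∑ l ∈ s, A k l * a k * (starRingEnd ℂ) (a l)

theorem norm_quadForm_le {G : Type*} [AddCommGroup G] {β : G → ℝ} (hβ : ∀ m, 0 ≤ β m)
    (hs : Summable β) (A : G → G → ℂ) (s : Finset G) (a : G → ℂ)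
    (hA : ∀ k ∈ s, ∀ l ∈ s, ‖A k l‖ ≤ β (k - l)) :
    ‖quadForm A s a‖ ≤ (∑' m, β m) * ∑ k ∈ s, ‖a k‖ ^ 2 := by
  have hrow : ∀ k, ∑ l ∈ s, β (k - l) ≤ ∑' m, β m := fun k => by
    rw [← (Equiv.subLeft k).tsum_eq β]
    exact ((Equiv.subLeft k).summable_iff.2 hs).sum_le_tsum s (fun i _ => hβ _)
  have hcol : ∀ l, ∑ k ∈ s, β (k - l) ≤ ∑' m, β m := fun l => by
    rw [← (Equiv.subRight l).tsum_eq β]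
    exact ((Equiv.subRight l).summable_iff.2 hs).sum_le_tsum s (fun i _ => hβ _)
  calc ‖quadForm A s a‖
      ≤ ∑ k ∈ s, ∑ l ∈ s, ‖A k l * a k * (starRingEnd ℂ) (a l)‖ :=
        (norm_sum_le _ _).trans (Finset.sum_le_sum fun k _ => norm_sum_le _ _)
    _ ≤ ∑ k ∈ s, ∑ l ∈ s, (β (k - l) * ‖a k‖ ^ 2 / 2 + β (k - l) * ‖a l‖ ^ 2 / 2) := by
        refine Finset.sum_le_sum fun k hk => Finset.sum_le_sum fun l hl => ?_
        rw [norm_mul, norm_mul, RCLike.norm_conj]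
        have h1 : ‖A k l‖ * ‖a k‖ * ‖a l‖ ≤ β (k - l) * (‖a k‖ * ‖a l‖) := by
          rw [mul_assoc]
          exact mul_le_mul_of_nonneg_right (hA k hk l hl) (by positivity)
        nlinarith [mul_nonneg (hβ (k - l)) (sq_nonneg (‖a k‖ - ‖a l‖))]
    _ = (∑ k ∈ s, (∑ l ∈ s, β (k - l)) * ‖a k‖ ^ 2) / 2
        + (∑ l ∈ s, (∑ k ∈ s, β (k - l)) * ‖a l‖ ^ 2) / 2 := by
        simp_rw [Finset.sum_add_distrib, Finset.sum_mul, Finset.sum_div]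
        congr 1
        exact Finset.sum_comm
    _ ≤ (∑ k ∈ s, (∑' m, β m) * ‖a k‖ ^ 2) / 2
        + (∑ l ∈ s, (∑' m, β m) * ‖a l‖ ^ 2) / 2 := by
        gcongr with k _ l _
        · exact hrow k
        · exact hcol l
    _ = _ := by rw [← Finset.mul_sum]; ring

/-- The cube `[0, D)ⁿ` of lattice points. -/
noncomputable def cube (n D : ℕ) : Finset (Fin n → ℤ) :=
  Fintype.piFinset fun _ => Finset.Ico 0 (D : ℤ)

/-- The number of lattice points of the cube that stay in it after translation by `-m`. -/
noncomputable def cubeOverlap (n D : ℕ) (m : Fin n → ℤ) : ℕ :=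
  ((cube n D).filter fun b => b - m ∈ cube n D).card

theorem cubeOverlap_le (n D : ℕ) (m : Fin n → ℤ) : cubeOverlap n D m ≤ D ^ n := by
  refine (Finset.card_filter_le _ _).trans ?_
  simp [cube, Fintype.card_piFinset]

theorem cubeOverlap_zero (n D : ℕ) : cubeOverlap n D 0 = D ^ n := by
  rw [cubeOverlap, Finset.filter_true_of_mem (by simp)]
  simp [cube, Fintype.card_piFinset]

theorem tendsto_cubeOverlap (n : ℕ) (m : Fin n → ℤ) :
    Filter.Tendsto (fun D : ℕ => (cubeOverlap n D m : ℝ) / (D : ℝ) ^ n) Filter.atTop (nhds 1) := by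
  have hcard : ∀ D : ℕ, cubeOverlap n D m =
      ∏ j, (min (D : ℤ) (D + m j) - max 0 (m j)).toNat := fun D => by
    have : (cube n D).filter (fun b => b - m ∈ cube n D) =
        Fintype.piFinset fun j => Finset.Ico (max 0 (m j)) (min (D : ℤ) (D + m j)) := by
      ext b
      simp only [cube, Finset.mem_filter, Fintype.mem_piFinset, Finset.mem_Ico, Pi.sub_apply,
        max_le_iff, lt_min_iff]
      constructor
      · rintro ⟨h1, h2⟩ j
        have := h1 j; have := h2 j; omega
      · intro h
        exact ⟨fun j => by have := h j; omega, fun j => by have := h j; omega⟩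
    rw [cubeOverlap, this, Fintype.card_piFinset]
    simp
  have hfac : ∀ j, Filter.Tendsto
      (fun D : ℕ => ((min (D : ℤ) (D + m j) - max 0 (m j)).toNat : ℝ) / D) Filter.atTop
      (nhds 1) := fun j => by
    have h1 : Filter.Tendsto (fun D : ℕ => 1 - (|m j| : ℝ) / D) Filter.atTop (nhds (1 - 0)) :=
      tendsto_const_nhds.sub (tendsto_const_div_atTop_nhds_zero_nat _)
    rw [sub_zero] at h1
    refine h1.congr' ?_
    filter_upwards [Filter.eventually_ge_atTop ((m j).natAbs + 1)] with D hD
    have hD0 : (D : ℝ) ≠ 0 := by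
      have : 0 < D := by omega
      positivity
    have h2 : ((min (D : ℤ) (D + m j) - max 0 (m j)).toNat : ℤ) = D - |m j| := by
      rw [Int.abs_eq_natAbs]; omega
    have h3 : ((min (D : ℤ) (D + m j) - max 0 (m j)).toNat : ℝ) = D - |(m j : ℝ)| := by
      exact_mod_cast congrArg (Int.cast : ℤ → ℝ) h2
    rw [h3]
    field_simp
  have := tendsto_finsetProd (Finset.univ : Finset (Fin n)) (fun j _ => hfac j)
  simp only [Finset.prod_const_one] at this
  refine this.congr fun D => ?_
  rw [hcard, Finset.prod_div_distrib]
  simp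

/-- Lower bounds for a band-dominated form can be checked on large cubic windows. -/
theorem exists_window_size {n : ℕ} {β : (Fin n → ℤ) → ℝ} (hβ : ∀ m, 0 ≤ β m)
    (hs : Summable β) {ε : ℝ} (hε : 0 < ε) :
    ∃ D : ℕ, ∀ (A : (Fin n → ℤ) → (Fin n → ℤ) → ℂ) (s : Finset (Fin n → ℤ))
      (a : (Fin n → ℤ) → ℂ) (δ : ℝ), (∀ k l, ‖A k l‖ ≤ β (k - l)) →
      (∀ z, δ * ∑ k ∈ s with k - z ∈ cube n D, ‖a k‖ ^ 2 ≤
        (quadForm A (s.filter fun k => k - z ∈ cube n D) a).re) →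
      (δ - ε) * ∑ k ∈ s, ‖a k‖ ^ 2 ≤ (quadForm A s a).re := by
  classical
  have hlim : Filter.Tendsto
      (fun D : ℕ => ∑' m, β m * (1 - (cubeOverlap n D m : ℝ) / (D : ℝ) ^ n)) Filter.atTop
      (nhds 0) := by
    have h0 : (0 : ℝ) = ∑' m : Fin n → ℤ, β m * (1 - 1) := by simp
    rw [h0]
    refine tendsto_tsum_of_dominated_convergence hs
      (fun m => ((tendsto_cubeOverlap n m).const_sub 1).const_mul (β m)) ?_
    refine Filter.Eventually.of_forall fun D m => ?_
    have h1 : (cubeOverlap n D m : ℝ) ≤ (D : ℝ) ^ n := by exact_mod_cast cubeOverlap_le n D m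
    have h2 : (cubeOverlap n D m : ℝ) / (D : ℝ) ^ n ≤ 1 := div_le_one_of_le₀ h1 (by positivity)
    have h3 : 0 ≤ (cubeOverlap n D m : ℝ) / (D : ℝ) ^ n := by positivity
    rw [Real.norm_eq_abs, abs_of_nonneg (mul_nonneg (hβ m) (by linarith))]
    nlinarith [hβ m]
  obtain ⟨D, hD, hDpos⟩ := ((hlim.eventually (gt_mem_nhds hε)).and
    (Filter.eventually_gt_atTop 0)).exists
  refine ⟨D, fun A s a δ hA hz => ?_⟩
  set Z : Finset (Fin n → ℤ) := (s ×ˢ cube n D).image fun p => p.1 - p.2 with hZ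
  have hcount : ∀ k ∈ s, ∀ l, (Z.filter fun z => k - z ∈ cube n D ∧ l - z ∈ cube n D).card
      = cubeOverlap n D (k - l) := fun k hk l => by
    rw [cubeOverlap]
    refine Finset.card_bij (fun z _ => k - z) ?_ ?_ ?_
    · intro z hzm
      simp only [Finset.mem_filter] at hzm ⊢
      refine ⟨hzm.2.1, ?_⟩
      have : k - z - (k - l) = l - z := by abel
      rw [this]; exact hzm.2.2
    · intro z _ z' _ h
      exact sub_right_injective h
    · intro b hb
      simp only [Finset.mem_filter] at hb
      refine ⟨k - b, ?_, by abel⟩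
      simp only [Finset.mem_filter, hZ, Finset.mem_image, Finset.mem_product, Prod.exists]
      refine ⟨⟨k, b, ⟨hk, hb.1⟩, rfl⟩, ?_, ?_⟩
      · simpa using hb.1
      · have : l - (k - b) = b - (k - l) := by abel
        rw [this]; exact hb.2
  have hDn : (0 : ℝ) < (D : ℝ) ^ n := by positivity
  have hsumN : ∑ z ∈ Z, ∑ k ∈ s with k - z ∈ cube n D, ‖a k‖ ^ 2
      = (D : ℝ) ^ n * ∑ k ∈ s, ‖a k‖ ^ 2 := by
    simp_rw [Finset.sum_filter]
    rw [Finset.sum_comm, Finset.mul_sum]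
    refine Finset.sum_congr rfl fun k hk => ?_
    rw [← Finset.sum_filter, Finset.sum_const, nsmul_eq_mul]
    have := hcount k hk k
    simp only [and_self, sub_self, cubeOverlap_zero] at this
    rw [this]; push_cast; rfl
  have hsumQ : ∑ z ∈ Z, quadForm A (s.filter fun k => k - z ∈ cube n D) a
      = quadForm (fun k l => (cubeOverlap n D (k - l) : ℂ) * A k l) s a := by
    unfold quadForm
    simp_rw [Finset.sum_filter]
    rw [Finset.sum_comm]
    refine Finset.sum_congr rfl fun k hk => ?_
    have : ∀ z, (if k - z ∈ cube n D then
          ∑ l ∈ s, (if l - z ∈ cube n D then A k l * a k * (starRingEnd ℂ) (a l) else 0) else 0)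
        = ∑ l ∈ s, if k - z ∈ cube n D ∧ l - z ∈ cube n D then
            A k l * a k * (starRingEnd ℂ) (a l) else 0 := fun z => by
      by_cases h : k - z ∈ cube n D <;> simp [h]
    simp_rw [this]
    rw [Finset.sum_comm]
    refine Finset.sum_congr rfl fun l _ => ?_
    rw [← Finset.sum_filter, Finset.sum_const, nsmul_eq_mul, hcount k hk l]
    ring
  have hdiff : (D : ℂ) ^ n * quadForm A s a
      - quadForm (fun k l => (cubeOverlap n D (k - l) : ℂ) * A k l) s a
      = (D : ℂ) ^ n * quadForm
        (fun k l => (1 - (cubeOverlap n D (k - l) : ℂ) / (D : ℂ) ^ n) * A k l) s a := by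
    have hD' : (D : ℂ) ^ n ≠ 0 := by exact_mod_cast hDn.ne'
    unfold quadForm
    simp_rw [Finset.mul_sum]
    rw [← Finset.sum_sub_distrib]
    refine Finset.sum_congr rfl fun k _ => ?_
    rw [← Finset.sum_sub_distrib]
    refine Finset.sum_congr rfl fun l _ => ?_
    field_simp
  have hfrac : ∀ m, 0 ≤ 1 - (cubeOverlap n D m : ℝ) / (D : ℝ) ^ n := fun m => by
    have h1 : (cubeOverlap n D m : ℝ) ≤ (D : ℝ) ^ n := by exact_mod_cast cubeOverlap_le n D m
    linarith [div_le_one_of_le₀ h1 hDn.le]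
  have herr := norm_quadForm_le
    (β := fun m => β m * (1 - (cubeOverlap n D m : ℝ) / (D : ℝ) ^ n))
    (fun m => mul_nonneg (hβ m) (hfrac m))
    (Summable.of_nonneg_of_le (fun m => mul_nonneg (hβ m) (hfrac m))
      (fun m => mul_le_of_le_one_right (hβ m) (by linarith [show
        0 ≤ (cubeOverlap n D m : ℝ) / (D : ℝ) ^ n by positivity])) hs)
    (fun k l => (1 - (cubeOverlap n D (k - l) : ℂ) / (D : ℂ) ^ n) * A k l) s a
    (fun k _ l _ => by
      have : (1 - (cubeOverlap n D (k - l) : ℂ) / (D : ℂ) ^ n)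
          = ((1 - (cubeOverlap n D (k - l) : ℝ) / (D : ℝ) ^ n : ℝ) : ℂ) := by push_cast; rfl
      rw [norm_mul, this, Complex.norm_real, Real.norm_eq_abs, abs_of_nonneg (hfrac _), mul_comm]
      exact mul_le_mul_of_nonneg_right (hA k l) (hfrac _))
  have hN : 0 ≤ ∑ k ∈ s, ‖a k‖ ^ 2 := by positivity
  have hre : -(ε * ∑ k ∈ s, ‖a k‖ ^ 2) ≤ (quadForm
      (fun k l => (1 - (cubeOverlap n D (k - l) : ℂ) / (D : ℂ) ^ n) * A k l) s a).re := by
    have h1 := (abs_le.1 (Complex.abs_re_le_norm (quadForm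
      (fun k l => (1 - (cubeOverlap n D (k - l) : ℂ) / (D : ℂ) ^ n) * A k l) s a))).1
    have h2 := mul_le_mul_of_nonneg_right hD.le hN
    linarith
  have hlow : δ * ((D : ℝ) ^ n * ∑ k ∈ s, ‖a k‖ ^ 2) ≤
      (quadForm (fun k l => (cubeOverlap n D (k - l) : ℂ) * A k l) s a).re := by
    rw [← hsumQ, ← hsumN, Complex.re_sum, Finset.mul_sum]
    exact Finset.sum_le_sum fun z _ => hz z
  have hcast : ∀ w : ℂ, ((D : ℂ) ^ n * w).re = (D : ℝ) ^ n * w.re := fun w => by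
    have : (D : ℂ) ^ n = (((D : ℝ) ^ n : ℝ) : ℂ) := by push_cast; rfl
    rw [this, Complex.re_ofReal_mul]
  have hfin := congrArg Complex.re hdiff
  rw [Complex.sub_re, hcast, hcast] at hfin
  refine le_of_mul_le_mul_left ?_ hDn
  nlinarith [mul_le_mul_of_nonneg_left hre hDn.le]

/-- Squared Fourier integral of an interval, i.e. the Fourier transform of a tent. -/
noncomputable def tentFT (h s : ℝ) : ℂ :=
  (∫ u in Set.Icc (0 : ℝ) h, Complex.exp (Complex.I * (s * u : ℝ))) ^ 2

theorem tentFT_zero {h : ℝ} (hh : 0 ≤ h) : tentFT h 0 = (h : ℂ) ^ 2 := by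
  simp [tentFT, hh]

theorem norm_tentFT_le {h : ℝ} (hh : 0 ≤ h) (s : ℝ) : ‖tentFT h s‖ ≤ h ^ 2 := by
  rw [tentFT, norm_pow]
  gcongr
  refine (norm_setIntegral_le_of_norm_le_const (C := 1) (by simp) fun x _ => ?_).trans ?_
  · rw [Complex.norm_exp_I_mul_ofReal]
  · simp [hh]

theorem sq_mul_norm_tentFT_le {h : ℝ} (hh : 0 ≤ h) (s : ℝ) : s ^ 2 * ‖tentFT h s‖ ≤ 4 := by
  rcases eq_or_ne s 0 with rfl | hs
  · simp
  have hc : Complex.I * (s : ℂ) ≠ 0 := mul_ne_zero Complex.I_ne_zero (by exact_mod_cast hs)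
  have h1 : ∫ u in Set.Icc (0 : ℝ) h, Complex.exp (Complex.I * (s * u : ℝ))
      = (Complex.exp (Complex.I * (s * h : ℝ)) - 1) / (Complex.I * s) := by
    rw [integral_Icc_eq_integral_Ioc, ← intervalIntegral.integral_of_le hh]
    have := integral_exp_mul_complex (a := 0) (b := h) hc
    simp only [Complex.ofReal_zero, mul_zero, Complex.exp_zero] at this
    rw [Complex.ofReal_mul, ← mul_assoc, ← this]
    simp_rw [Complex.ofReal_mul, mul_assoc]
  have h2 : ‖Complex.exp (Complex.I * (s * h : ℝ)) - 1‖ ≤ 2 := by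
    refine (norm_sub_le _ _).trans ?_
    rw [Complex.norm_exp_I_mul_ofReal]; norm_num
  rw [tentFT, h1, norm_pow, norm_div, norm_mul, Complex.norm_I, one_mul, Complex.norm_real,
    div_pow, Real.norm_eq_abs, sq_abs, mul_div_cancel₀ _ (pow_ne_zero 2 hs)]
  nlinarith [norm_nonneg (Complex.exp (Complex.I * (s * h : ℝ)) - 1)]

noncomputable def tentProd {n : ℕ} (h : ℝ) (m : Fin n → ℤ) : ℂ := ∏ j, tentFT h (m j)

theorem summable_norm_tentFT {h : ℝ} (hh : 0 ≤ h) : Summable fun m : ℤ => ‖tentFT h m‖ := by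
  have h2 : Summable fun m : ℤ => 4 * (1 / (m : ℝ) ^ 2) :=
    (Real.summable_one_div_int_pow.2 one_lt_two).mul_left 4
  refine h2.of_norm_bounded_eventually ?_
  rw [Filter.eventually_cofinite]
  refine (Set.finite_singleton (0 : ℤ)).subset fun m hm => ?_
  by_contra h0
  refine hm ?_
  have hm0 : (0 : ℝ) < (m : ℝ) ^ 2 := by
    have : (m : ℝ) ≠ 0 := by exact_mod_cast h0
    positivity
  rw [norm_norm, mul_one_div, le_div_iff₀ hm0, mul_comm]
  exact sq_mul_norm_tentFT_le hh m

theorem summable_norm_tentProd {n : ℕ} {h : ℝ} (hh : 0 ≤ h) :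
    Summable fun m : Fin n → ℤ => ‖tentProd h m‖ := by
  classical
  refine summable_of_sum_le (c := ∏ _j : Fin n, ∑' m : ℤ, ‖tentFT h m‖)
    (fun _ => norm_nonneg _) fun s => ?_
  calc ∑ m ∈ s, ‖tentProd h m‖
      ≤ ∑ m ∈ Fintype.piFinset (fun j => s.image fun m => m j), ‖tentProd h m‖ := by
        refine Finset.sum_le_sum_of_subset_of_nonneg (fun m hm => ?_) fun _ _ _ => norm_nonneg _
        exact Fintype.mem_piFinset.2 fun j => Finset.mem_image_of_mem _ hm
    _ = ∏ j : Fin n, ∑ i ∈ s.image (fun m : Fin n → ℤ => m j), ‖tentFT h (i : ℤ)‖ := by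
        rw [Finset.prod_univ_sum]
        simp [tentProd, norm_prod]
    _ ≤ _ := Finset.prod_le_prod (fun _ _ => by positivity) fun j _ =>
        (summable_norm_tentFT hh).sum_le_tsum _ fun _ _ => norm_nonneg _

/-- Points `(t, x)` of space-time. -/
abbrev SpaceTime (n : ℕ) := ℝ × (Fin n → ℝ)

/-- The cube `[0, h]^{1+n}` in space-time. -/
def stBox (n : ℕ) (h : ℝ) : Set (SpaceTime n) :=
  Set.Icc 0 h ×ˢ Set.Icc 0 fun _ => h

/-- The plane wave with wave vector `k` and frequency `θ k`. -/
noncomputable def wave {n : ℕ} (θ : (Fin n → ℤ) → ℝ) (k : Fin n → ℤ) (y : SpaceTime n) : ℂ :=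
  Complex.exp (Complex.I * (∑ j, (k j : ℝ) * y.2 j - θ k * y.1 : ℝ))

noncomputable def waveSum {n : ℕ} (θ : (Fin n → ℤ) → ℝ) (s : Finset (Fin n → ℤ))
    (a : (Fin n → ℤ) → ℂ) (y : SpaceTime n) : ℂ := ∑ k ∈ s, a k * wave θ k y

/-- Integral of `|waveSum|²` against a tent function. -/
noncomputable def tentEnergy {n : ℕ} (h : ℝ) (θ : (Fin n → ℤ) → ℝ) (s : Finset (Fin n → ℤ))
    (a : (Fin n → ℤ) → ℂ) : ℝ :=
  ∫ u in stBox n h, ∫ w in stBox n h, ‖waveSum θ s a (u + w)‖ ^ 2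

section

variable {n : ℕ} {θ : (Fin n → ℤ) → ℝ}

theorem isCompact_stBox (n : ℕ) (h : ℝ) : IsCompact (stBox n h) := isCompact_Icc.prod isCompact_Icc

theorem stBox_mono {h h' : ℝ} (hh : h ≤ h') : stBox n h ⊆ stBox n h' :=
  Set.prod_mono (Set.Icc_subset_Icc_right hh) (Set.Icc_subset_Icc_right fun _ => hh)

theorem add_mem_stBox {h h' : ℝ} {u w : SpaceTime n} (hu : u ∈ stBox n h) (hw : w ∈ stBox n h') :
    u + w ∈ stBox n (h + h') :=
  ⟨⟨add_nonneg hu.1.1 hw.1.1, add_le_add hu.1.2 hw.1.2⟩,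
    ⟨add_nonneg hu.2.1 hw.2.1, add_le_add hu.2.2 hw.2.2⟩⟩

theorem wave_add (k : Fin n → ℤ) (y z : SpaceTime n) :
    wave θ k (y + z) = wave θ k y * wave θ k z := by
  rw [wave, wave, wave, ← Complex.exp_add, ← mul_add, ← Complex.ofReal_add]
  congr 3
  simp only [Prod.snd_add, Prod.fst_add, Pi.add_apply, mul_add, Finset.sum_add_distrib]
  ring

theorem norm_wave (k : Fin n → ℤ) (y : SpaceTime n) : ‖wave θ k y‖ = 1 :=
  Complex.norm_exp_I_mul_ofReal _

@[fun_prop]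
theorem continuous_wave (k : Fin n → ℤ) : Continuous (wave θ k) := by
  unfold wave; fun_prop

@[fun_prop]
theorem continuous_waveSum (s : Finset (Fin n → ℤ)) (a : (Fin n → ℤ) → ℂ) :
    Continuous (waveSum θ s a) := by
  unfold waveSum; fun_prop

theorem continuous_inner_integral (h : ℝ) {f : SpaceTime n → ℝ} (hf : Continuous f) :
    Continuous fun u => ∫ w in stBox n h, f (u + w) :=
  continuous_parametric_integral_of_continuous (by fun_prop) (isCompact_stBox n h)

theorem setIntegral_stBox_add_le {f : SpaceTime n → ℝ} (hf : Continuous f) (hf0 : ∀ y, 0 ≤ f y)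
    {h τ : ℝ} {η : SpaceTime n} (hη : η ∈ stBox n τ) :
    ∫ u in stBox n h, f (u + η) ≤ ∫ u in stBox n (h + τ), f u := by
  have hpre : (fun u : SpaceTime n => u + η) ⁻¹' {y | y - η ∈ stBox n h} = stBox n h := by
    ext u; simp
  have hmp : MeasurePreserving (fun u : SpaceTime n => u + η) volume volume :=
    measurePreserving_add_right ((volume : Measure ℝ).prod (volume : Measure (Fin n → ℝ))) η
  rw [← hpre, hmp.setIntegral_preimage_emb (measurableEmbedding_addRight η) f]
  refine setIntegral_mono_set (hf.continuousOn.integrableOn_compact (isCompact_stBox n _))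
    (Filter.Eventually.of_forall hf0) (Filter.Eventually.of_forall fun y hy => ?_)
  have := add_mem_stBox (show y - η ∈ stBox n h from hy) hη
  rw [sub_add_cancel] at this
  exact this

theorem tentEnergy_shift_le (s : Finset (Fin n → ℤ)) (a : (Fin n → ℤ) → ℂ) {h τ : ℝ}
    (hτ : 0 ≤ τ) {η : SpaceTime n} (hη : η ∈ stBox n τ) :
    ∫ u in stBox n h, ∫ w in stBox n h, ‖waveSum θ s a (u + w + η)‖ ^ 2
      ≤ tentEnergy (h + τ) θ s a := by
  have hc : Continuous fun y => ‖waveSum θ s a y‖ ^ 2 := by fun_prop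
  have h1 := setIntegral_stBox_add_le (continuous_inner_integral (h + τ) hc)
    (fun y => by positivity) (h := h) hη
  refine le_trans (setIntegral_mono_on ?_ ?_ (isCompact_stBox n h).measurableSet
    fun u _ => ?_) h1
  · refine ContinuousOn.integrableOn_compact (isCompact_stBox n h) (Continuous.continuousOn ?_)
    have := (continuous_inner_integral h hc).comp (continuous_add_const η)
    refine this.congr fun u => ?_
    simp only [Function.comp]
    refine integral_congr_ae (Filter.Eventually.of_forall fun w => ?_)
    simp only [add_right_comm]
  · exact ((continuous_inner_integral (h + τ) hc).comp
      (continuous_add_const η)).continuousOn.integrableOn_compact (isCompact_stBox n h)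
  · have : ∀ w, u + w + η = u + η + w := fun w => add_right_comm _ _ _
    simp_rw [this]
    refine setIntegral_mono_set ?_ (Filter.Eventually.of_forall fun y => by positivity)
      (stBox_mono (by linarith)).eventuallyLE
    exact (Continuous.continuousOn (by fun_prop)).integrableOn_compact (isCompact_stBox n _)

theorem tentEnergy_mono (s : Finset (Fin n → ℤ)) (a : (Fin n → ℤ) → ℂ) {h h' : ℝ} (hh : h ≤ h') :
    tentEnergy h θ s a ≤ tentEnergy h' θ s a := by
  have h0 : (0 : SpaceTime n) ∈ stBox n (h' - h) := by
    refine ⟨⟨le_rfl, sub_nonneg.2 hh⟩, ⟨le_rfl, fun _ => sub_nonneg.2 hh⟩⟩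
  simpa [tentEnergy] using tentEnergy_shift_le (θ := θ) s a (h := h) (sub_nonneg.2 hh) h0

theorem tentEnergy_le (s : Finset (Fin n → ℤ)) (a : (Fin n → ℤ) → ℂ) (h : ℝ) :
    tentEnergy h θ s a ≤
      volume.real (stBox n h) * ∫ y in stBox n (h + h), ‖waveSum θ s a y‖ ^ 2 := by
  have hc : Continuous fun y => ‖waveSum θ s a y‖ ^ 2 := by fun_prop
  have hfin := (isCompact_stBox n h).measure_lt_top (μ := volume)
  calc tentEnergy h θ s a ≤ ∫ _u in stBox n h, ∫ y in stBox n (h + h), ‖waveSum θ s a y‖ ^ 2 := by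
        refine setIntegral_mono_on ((continuous_inner_integral h
          hc).continuousOn.integrableOn_compact (isCompact_stBox n h))
          (integrableOn_const hfin.ne) (isCompact_stBox n h).measurableSet fun u hu => ?_
        simp_rw [add_comm u]
        exact setIntegral_stBox_add_le hc (fun y => by positivity) hu
    _ = _ := by simp

theorem setIntegral_wave_sub (h : ℝ) (k l : Fin n → ℤ) :
    ∫ y in stBox n h, wave θ k y * (starRingEnd ℂ) (wave θ l y) =
      (∫ u in Set.Icc (0 : ℝ) h, Complex.exp (Complex.I * ((θ l - θ k) * u : ℝ))) *
      ∏ j, ∫ u in Set.Icc (0 : ℝ) h, Complex.exp (Complex.I * (((k - l) j : ℝ) * u : ℝ)) := by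
  have h1 : ∀ y : SpaceTime n, wave θ k y * (starRingEnd ℂ) (wave θ l y) =
      Complex.exp (Complex.I * ((θ l - θ k) * y.1 : ℝ)) *
      ∏ j, Complex.exp (Complex.I * (((k - l) j : ℝ) * y.2 j : ℝ)) := fun y => by
    rw [wave, wave, ← Complex.exp_conj, ← Complex.exp_sum, ← Complex.exp_add, ← Complex.exp_add,
      map_mul, Complex.conj_I, Complex.conj_ofReal, ← Finset.mul_sum]
    congr 1
    push_cast [Pi.sub_apply]
    simp only [sub_mul, Finset.sum_sub_distrib]
    ring
  simp_rw [h1]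
  rw [stBox, Measure.volume_eq_prod, setIntegral_prod_mul
    (fun t : ℝ => Complex.exp (Complex.I * ((θ l - θ k) * t : ℝ)))
    (fun x : Fin n → ℝ => ∏ j, Complex.exp (Complex.I * (((k - l) j : ℝ) * x j : ℝ)))]
  congr 1
  rw [← Set.pi_univ_Icc, volume_pi, Measure.restrict_pi_pi]
  exact integral_fintype_prod_eq_prod (μ := fun _ : Fin n => volume.restrict (Set.Icc (0 : ℝ) h))
    (fun j (x : ℝ) => Complex.exp (Complex.I * (((k - l) j : ℝ) * x : ℝ)))

theorem ofReal_tentEnergy (h : ℝ) (s : Finset (Fin n → ℤ)) (a : (Fin n → ℤ) → ℂ) :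
    (tentEnergy h θ s a : ℂ) =
      quadForm (fun k l => tentProd h (k - l) * tentFT h (θ l - θ k)) s a := by
  have hI : ∀ f : SpaceTime n → ℂ, Continuous f → Integrable f (volume.restrict (stBox n h)) :=
    fun f hf => hf.continuousOn.integrableOn_compact (isCompact_stBox n h)
  have hexp : ∀ y : SpaceTime n, ((‖waveSum θ s a y‖ ^ 2 : ℝ) : ℂ) =
      ∑ k ∈ s, ∑ l ∈ s, a k * (starRingEnd ℂ) (a l) *
        (wave θ k y * (starRingEnd ℂ) (wave θ l y)) := fun y => by
    rw [Complex.ofReal_pow, ← Complex.mul_conj', waveSum, map_sum, Finset.sum_mul_sum]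
    refine Finset.sum_congr rfl fun k _ => Finset.sum_congr rfl fun l _ => ?_
    rw [map_mul]; ring
  have hsplit : ∀ u w : SpaceTime n, ((‖waveSum θ s a (u + w)‖ ^ 2 : ℝ) : ℂ) =
      ∑ k ∈ s, ∑ l ∈ s, a k * (starRingEnd ℂ) (a l) *
        (wave θ k u * (starRingEnd ℂ) (wave θ l u)) *
        (wave θ k w * (starRingEnd ℂ) (wave θ l w)) := fun u w => by
    rw [hexp]
    refine Finset.sum_congr rfl fun k _ => Finset.sum_congr rfl fun l _ => ?_
    rw [wave_add, wave_add, map_mul]; ring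
  have hconj : Continuous fun z : ℂ => (starRingEnd ℂ) z := Complex.continuous_conj
  rw [tentEnergy, ← integral_complex_ofReal]
  simp_rw [← integral_complex_ofReal, hsplit]
  have hinner : ∀ u : SpaceTime n, ∫ w in stBox n h, ∑ k ∈ s, ∑ l ∈ s,
      a k * (starRingEnd ℂ) (a l) * (wave θ k u * (starRingEnd ℂ) (wave θ l u)) *
        (wave θ k w * (starRingEnd ℂ) (wave θ l w)) =
      ∑ k ∈ s, ∑ l ∈ s, a k * (starRingEnd ℂ) (a l) *
        (∫ w in stBox n h, wave θ k w * (starRingEnd ℂ) (wave θ l w)) *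
        (wave θ k u * (starRingEnd ℂ) (wave θ l u)) := fun u => by
    rw [integral_finsetSum _ fun k _ => hI _ (by fun_prop)]
    refine Finset.sum_congr rfl fun k _ => ?_
    rw [integral_finsetSum _ fun l _ => hI _ (by fun_prop)]
    refine Finset.sum_congr rfl fun l _ => ?_
    rw [integral_const_mul]
    ring
  simp_rw [hinner]
  rw [integral_finsetSum _ fun k _ => hI _ (by fun_prop)]
  refine Finset.sum_congr rfl fun k _ => ?_
  rw [integral_finsetSum _ fun l _ => hI _ (by fun_prop)]
  refine Finset.sum_congr rfl fun l _ => ?_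
  rw [integral_const_mul, setIntegral_wave_sub]
  simp only [tentProd, tentFT, Finset.prod_pow]
  ring

end

theorem exists_pos_forall_le {ι : Type*} (s : Finset ι) (f : ι → ℝ) (hf : ∀ i ∈ s, 0 < f i) :
    ∃ κ > 0, ∀ i ∈ s, κ ≤ f i := by
  rcases s.eq_empty_or_nonempty with rfl | hs
  · exact ⟨1, one_pos, by simp⟩
  · obtain ⟨i, hi, hmin⟩ := Finset.exists_min_image s f hs
    exact ⟨f i, hf i hi, hmin⟩

theorem norm_exp_sub_one_sq (x : ℝ) :
    ‖Complex.exp (Complex.I * (x : ℝ)) - 1‖ ^ 2 = 2 - 2 * Real.cos x := by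
  rw [Complex.norm_exp_I_mul_ofReal_sub_one, Real.norm_eq_abs, sq_abs, mul_pow,
    Real.sin_sq_eq_half_sub]
  rw [mul_div_cancel₀ x two_ne_zero]
  ring

/-- The mean square displacement of `α ↦ exp (i m α)` is bounded below uniformly in `m ≠ 0`. -/
theorem exists_le_integral_norm_exp_sub_one {τ : ℝ} (hτ : 0 < τ) :
    ∃ κ > 0, ∀ m : ℤ, m ≠ 0 →
      κ ≤ ∫ α in (0 : ℝ)..τ, ‖Complex.exp (Complex.I * (m * α : ℝ)) - 1‖ ^ 2 := by
  have hval : ∀ m : ℤ, m ≠ 0 →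
      ∫ α in (0 : ℝ)..τ, ‖Complex.exp (Complex.I * (m * α : ℝ)) - 1‖ ^ 2
        = 2 * τ - 2 * (Real.sin (m * τ) / m) := fun m hm => by
    have hm' : (m : ℝ) ≠ 0 := by exact_mod_cast hm
    simp_rw [norm_exp_sub_one_sq]
    rw [intervalIntegral.integral_sub (by simp)
      (Continuous.intervalIntegrable (by fun_prop) _ _), intervalIntegral.integral_const_mul,
      intervalIntegral.integral_comp_mul_left (fun x => Real.cos x) hm', integral_cos]
    simp
    ring
  have hlim : Filter.Tendsto (fun m : ℤ => 2 * τ - 2 * (Real.sin (m * τ) / m))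
      Filter.cofinite (nhds (2 * τ - 2 * 0)) := by
    refine tendsto_const_nhds.sub (Filter.Tendsto.const_mul _ ?_)
    have h0 : Filter.Tendsto (fun m : ℤ => ‖(m : ℝ)‖⁻¹) Filter.cofinite (nhds 0) := by
      have := tendsto_norm_cocompact_atTop.comp Int.tendsto_coe_cofinite
      exact tendsto_inv_atTop_zero.comp this
    refine squeeze_zero_norm (fun m => ?_) h0
    rw [norm_div, div_eq_mul_inv]
    exact mul_le_of_le_one_left (by positivity) (Real.abs_sin_le_one _)
  have hev : ∀ᶠ m : ℤ in Filter.cofinite, τ ≤ 2 * τ - 2 * (Real.sin (m * τ) / m) :=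
    hlim.eventually (le_mem_nhds (by linarith))
  have hpos : ∀ m : ℤ, m ≠ 0 → 0 < 2 * τ - 2 * (Real.sin (m * τ) / m) := fun m hm => by
    rcases lt_or_gt_of_ne hm with h | h
    · have h' : (m : ℝ) < 0 := by exact_mod_cast h
      have := Real.lt_sin (mul_neg_of_neg_of_pos h' hτ)
      have : Real.sin (m * τ) / m < τ := by
        rw [div_lt_iff_of_neg h']; linarith
      linarith
    · have h' : (0 : ℝ) < m := by exact_mod_cast h
      have := Real.sin_lt (mul_pos h' hτ)
      have : Real.sin (m * τ) / m < τ := by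
        rw [div_lt_iff₀ h']; linarith
      linarith
  rw [Filter.eventually_cofinite] at hev
  obtain ⟨κ, hκ, hκle⟩ := exists_pos_forall_le (hev.toFinset.erase 0)
    (fun m : ℤ => 2 * τ - 2 * (Real.sin (m * τ) / m))
    fun m hm => hpos m (Finset.ne_of_mem_erase hm)
  refine ⟨min κ τ, lt_min hκ hτ, fun m hm => ?_⟩
  rw [hval m hm]
  by_cases hmem : τ ≤ 2 * τ - 2 * (Real.sin (m * τ) / m)
  · exact (min_le_right _ _).trans hmem
  · exact (min_le_left _ _).trans (hκle m
      (Finset.mem_erase.2 ⟨hm, hev.mem_toFinset.2 hmem⟩))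

section

variable {n : ℕ} {θ : (Fin n → ℤ) → ℝ}

theorem tentEnergy_nonneg (h : ℝ) (s : Finset (Fin n → ℤ)) (a : (Fin n → ℤ) → ℂ) :
    0 ≤ tentEnergy h θ s a :=
  integral_nonneg fun _ => integral_nonneg fun _ => by positivity

theorem norm_tentProd_mul_tentFT_le {h : ℝ} (hh : 0 ≤ h) (m : Fin n → ℤ) (r : ℝ) :
    ‖tentProd h m * tentFT h r‖ ≤ h ^ 2 * ‖tentProd h m‖ := by
  rw [norm_mul, mul_comm]
  exact mul_le_mul_of_nonneg_right (norm_tentFT_le hh _) (norm_nonneg _)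

theorem tentEnergy_le_sum {h : ℝ} (hh : 0 ≤ h) (s : Finset (Fin n → ℤ)) (a : (Fin n → ℤ) → ℂ) :
    tentEnergy h θ s a ≤
      (∑' m : Fin n → ℤ, h ^ 2 * ‖tentProd h m‖) * ∑ k ∈ s, ‖a k‖ ^ 2 := by
  have h1 := norm_quadForm_le (β := fun m : Fin n → ℤ => h ^ 2 * ‖tentProd h m‖)
    (fun m => by positivity) ((summable_norm_tentProd hh).mul_left _)
    (fun k l => tentProd h (k - l) * tentFT h (θ l - θ k)) s a
    (fun k _ l _ => norm_tentProd_mul_tentFT_le hh _ _)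
  rw [← ofReal_tentEnergy, Complex.norm_real] at h1
  exact (le_abs_self _).trans h1

theorem double_integral_le_of_le (h : ℝ) {f g₁ g₂ : SpaceTime n → ℝ} (hf : Continuous f)
    (hg₁ : Continuous g₁) (hg₂ : Continuous g₂) (hle : ∀ y, f y ≤ 2 * g₁ y + 2 * g₂ y) :
    ∫ u in stBox n h, ∫ w in stBox n h, f (u + w) ≤
      2 * (∫ u in stBox n h, ∫ w in stBox n h, g₁ (u + w)) +
      2 * ∫ u in stBox n h, ∫ w in stBox n h, g₂ (u + w) := by
  have hI : ∀ g : SpaceTime n → ℝ, Continuous g → IntegrableOn g (stBox n h) :=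
    fun g hg => hg.continuousOn.integrableOn_compact (isCompact_stBox n h)
  rw [← integral_const_mul, ← integral_const_mul,
    ← integral_add ((hI _ (continuous_inner_integral h hg₁)).const_mul _)
      ((hI _ (continuous_inner_integral h hg₂)).const_mul _)]
  refine setIntegral_mono (hI _ (continuous_inner_integral h hf))
    (((hI _ (continuous_inner_integral h hg₁)).const_mul _).add
      ((hI _ (continuous_inner_integral h hg₂)).const_mul _)) fun u => ?_
  rw [← integral_const_mul, ← integral_const_mul,
    ← integral_add ((hI _ (by fun_prop)).const_mul _) ((hI _ (by fun_prop)).const_mul _)]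
  exact setIntegral_mono (hI _ (by fun_prop))
    (((hI _ (by fun_prop)).const_mul _).add ((hI _ (by fun_prop)).const_mul _)) fun w => hle _

theorem norm_sub_sq_le (z w : ℂ) : ‖z - w‖ ^ 2 ≤ 2 * ‖z‖ ^ 2 + 2 * ‖w‖ ^ 2 := by
  have h1 := norm_sub_le z w
  nlinarith [sq_nonneg (‖z‖ - ‖w‖), norm_nonneg (z - w), norm_nonneg z, norm_nonneg w]

theorem tentEnergy_singleton {h : ℝ} (hh : 0 ≤ h) (k : Fin n → ℤ) (a : (Fin n → ℤ) → ℂ) :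
    tentEnergy h θ {k} a = (h ^ 2) ^ (n + 1) * ‖a k‖ ^ 2 := by
  have h1 := ofReal_tentEnergy (θ := θ) h {k} a
  have h2 : tentProd h (0 : Fin n → ℤ) = ((h : ℂ) ^ 2) ^ n := by
    simp [tentProd, tentFT_zero hh]
  simp only [quadForm, Finset.sum_singleton, sub_self, tentFT_zero hh, h2, mul_assoc] at h1
  rw [Complex.mul_conj'] at h1
  have : ((tentEnergy h θ {k} a : ℝ) : ℂ) = (((h ^ 2) ^ (n + 1) * ‖a k‖ ^ 2 : ℝ) : ℂ) := by
    rw [h1]; push_cast; ring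
  exact_mod_cast this

/-- The space translation by `α` in direction `j`. -/
noncomputable def spaceShift (j : Fin n) (α : ℝ) : SpaceTime n := (0, Pi.single j α)

theorem spaceShift_mem {j : Fin n} {α τ : ℝ} (h0 : 0 ≤ α) (h1 : α ≤ τ) :
    spaceShift j α ∈ stBox n τ := by
  refine ⟨⟨le_rfl, h0.trans h1⟩, Pi.single_nonneg.2 h0, fun i => ?_⟩
  rcases eq_or_ne i j with rfl | hij
  · simpa [spaceShift] using h1
  · simpa [spaceShift, hij] using h0.trans h1

theorem wave_spaceShift (k : Fin n → ℤ) (j : Fin n) (α : ℝ) :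
    wave θ k (spaceShift j α) = Complex.exp (Complex.I * (k j * α : ℝ)) := by
  simp [wave, spaceShift, Pi.single_apply]

theorem shifted_energy_le {Λ : Set (Fin n → ℤ)} {h δ : ℝ}
    (hobs : ∀ (s : Finset (Fin n → ℤ)) (a : (Fin n → ℤ) → ℂ), (∀ k ∈ s, k ∈ Λ) →
      δ * ∑ k ∈ s, ‖a k‖ ^ 2 ≤ tentEnergy h θ s a) {k₀ : Fin n → ℤ}
    {s : Finset (Fin n → ℤ)} (hs : ∀ k ∈ s, k ∈ insert k₀ Λ) (a : (Fin n → ℤ) → ℂ)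
    (j : Fin n) {α τ : ℝ} (h0 : 0 ≤ α) (h1 : α ≤ τ) :
    δ * ∑ k ∈ s.erase k₀,
        ‖a k‖ ^ 2 * ‖Complex.exp (Complex.I * (((k - k₀) j : ℤ) * α : ℝ)) - 1‖ ^ 2 ≤
      4 * tentEnergy (h + τ) θ s a := by
  have hτ : 0 ≤ τ := h0.trans h1
  have key := hobs (s.erase k₀)
    (fun k => a k * (Complex.exp (Complex.I * (((k - k₀) j : ℤ) * α : ℝ)) - 1))
    (fun k hk => (hs k (Finset.mem_of_mem_erase hk)).resolve_left (Finset.ne_of_mem_erase hk))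
  simp_rw [norm_mul, mul_pow] at key
  refine key.trans ?_
  have hfun : ∀ y, waveSum θ (s.erase k₀)
      (fun k => a k * (Complex.exp (Complex.I * (((k - k₀) j : ℤ) * α : ℝ)) - 1)) y =
      Complex.exp (Complex.I * (-(k₀ j * α) : ℝ)) * waveSum θ s a (y + spaceShift j α)
        - waveSum θ s a y := fun y => by
    have : waveSum θ (s.erase k₀)
        (fun k => a k * (Complex.exp (Complex.I * (((k - k₀) j : ℤ) * α : ℝ)) - 1)) y =
        waveSum θ s
        (fun k => a k * (Complex.exp (Complex.I * (((k - k₀) j : ℤ) * α : ℝ)) - 1)) y :=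
      Finset.sum_erase _ (by simp)
    rw [this, waveSum, waveSum, waveSum, Finset.mul_sum, ← Finset.sum_sub_distrib]
    refine Finset.sum_congr rfl fun k _ => ?_
    have he : Complex.exp (Complex.I * (((k - k₀) j : ℤ) * α : ℝ)) =
        Complex.exp (Complex.I * (-(k₀ j * α) : ℝ)) * Complex.exp (Complex.I * (k j * α : ℝ)) := by
      rw [← Complex.exp_add]
      congr 1
      push_cast [Pi.sub_apply]
      ring
    rw [wave_add, wave_spaceShift, he]
    ring
  have h2 : tentEnergy h θ (s.erase k₀)
      (fun k => a k * (Complex.exp (Complex.I * (((k - k₀) j : ℤ) * α : ℝ)) - 1)) ≤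
      2 * (∫ u in stBox n h, ∫ w in stBox n h, ‖waveSum θ s a (u + w + spaceShift j α)‖ ^ 2)
      + 2 * tentEnergy h θ s a := by
    refine double_integral_le_of_le h (g₁ := fun y => ‖waveSum θ s a (y + spaceShift j α)‖ ^ 2)
      (g₂ := fun y => ‖waveSum θ s a y‖ ^ 2)
      (f := fun y => ‖waveSum θ (s.erase k₀) _ y‖ ^ 2) (by fun_prop) (by fun_prop) (by fun_prop)
      fun y => ?_
    rw [hfun]
    refine (norm_sub_sq_le _ _).trans (le_of_eq ?_)
    rw [norm_mul, Complex.norm_exp_I_mul_ofReal, one_mul]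
  have h3 := tentEnergy_shift_le (θ := θ) s a (h := h) hτ (spaceShift_mem (j := j) h0 h1)
  have h4 := tentEnergy_mono (θ := θ) s a (show h ≤ h + τ by linarith)
  linarith

/-- Adding one wave vector to an observable family, at the price of a larger observation box. -/
theorem exists_observable_insert {Λ : Set (Fin n → ℤ)} {h h' δ : ℝ} (hh : 0 < h) (hhh : h < h')
    (hδ : 0 < δ)
    (hobs : ∀ (s : Finset (Fin n → ℤ)) (a : (Fin n → ℤ) → ℂ), (∀ k ∈ s, k ∈ Λ) →
      δ * ∑ k ∈ s, ‖a k‖ ^ 2 ≤ tentEnergy h θ s a) (k₀ : Fin n → ℤ) :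
    ∃ δ' > 0, ∀ (s : Finset (Fin n → ℤ)) (a : (Fin n → ℤ) → ℂ), (∀ k ∈ s, k ∈ insert k₀ Λ) →
      δ' * ∑ k ∈ s, ‖a k‖ ^ 2 ≤ tentEnergy h' θ s a := by
  obtain ⟨τ, hτ, rfl⟩ : ∃ τ, 0 < τ ∧ h' = h + τ := ⟨h' - h, by linarith, by ring⟩
  obtain ⟨κ, hκ, hκle⟩ := exists_le_integral_norm_exp_sub_one hτ
  set C : ℝ := ∑' m : Fin n → ℤ, h ^ 2 * ‖tentProd h m‖ with hC
  have hC0 : 0 ≤ C := tsum_nonneg fun _ => by positivity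
  set g : ℤ → ℝ := fun m => ∫ α in (0 : ℝ)..τ, ‖Complex.exp (Complex.I * (m * α : ℝ)) - 1‖ ^ 2
  have hg0 : ∀ m, 0 ≤ g m := fun m =>
    intervalIntegral.integral_nonneg hτ.le fun _ _ => by positivity
  set B : ℝ := 4 * τ * n / (δ * κ) with hB
  have hB0 : 0 ≤ B := by positivity
  have hP : 0 < (h ^ 2) ^ (n + 1) := by positivity
  set B₀ : ℝ := (2 + 2 * (C * B)) / (h ^ 2) ^ (n + 1) with hB₀
  have hB₀0 : 0 < B₀ := by positivity
  refine ⟨1 / (B + B₀), by positivity, fun s a hs => ?_⟩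
  set E := tentEnergy (h + τ) θ s a with hE
  have hE0 : 0 ≤ E := tentEnergy_nonneg _ _ _
  have hj : ∀ j, δ * ∑ k ∈ s.erase k₀, ‖a k‖ ^ 2 * g ((k - k₀) j) ≤ τ * (4 * E) := fun j => by
    have h1 : ∫ α in (0 : ℝ)..τ, δ * ∑ k ∈ s.erase k₀,
        ‖a k‖ ^ 2 * ‖Complex.exp (Complex.I * (((k - k₀) j : ℤ) * α : ℝ)) - 1‖ ^ 2 ≤
        ∫ _α in (0 : ℝ)..τ, 4 * E :=
      intervalIntegral.integral_mono_on hτ.le (Continuous.intervalIntegrable (by fun_prop) _ _)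
        (by simp) fun α hα => shifted_energy_le hobs hs a j hα.1 hα.2
    rw [intervalIntegral.integral_const_mul, intervalIntegral.integral_finsetSum
      fun k _ => Continuous.intervalIntegrable (by fun_prop) _ _] at h1
    simp_rw [intervalIntegral.integral_const_mul] at h1
    rw [intervalIntegral.integral_const, sub_zero, smul_eq_mul] at h1
    exact h1.trans_eq (by ring)
  have herase : ∑ k ∈ s.erase k₀, ‖a k‖ ^ 2 ≤ B * E := by
    have h1 : δ * ∑ j, ∑ k ∈ s.erase k₀, ‖a k‖ ^ 2 * g ((k - k₀) j) ≤ n * (τ * (4 * E)) := by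
      rw [Finset.mul_sum]
      refine (Finset.sum_le_sum fun j _ => hj j).trans (by simp)
    have h2 : κ * ∑ k ∈ s.erase k₀, ‖a k‖ ^ 2 ≤
        ∑ j, ∑ k ∈ s.erase k₀, ‖a k‖ ^ 2 * g ((k - k₀) j) := by
      rw [Finset.sum_comm, Finset.mul_sum]
      refine Finset.sum_le_sum fun k hk => ?_
      rw [← Finset.mul_sum, mul_comm]
      refine mul_le_mul_of_nonneg_left ?_ (by positivity)
      obtain ⟨j, hjk⟩ : ∃ j, (k - k₀) j ≠ 0 := by
        by_contra! hall
        exact Finset.ne_of_mem_erase hk (sub_eq_zero.1 (funext hall))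
      exact (hκle _ hjk).trans
        (Finset.single_le_sum (f := fun j => g ((k - k₀) j)) (fun j _ => hg0 _) (Finset.mem_univ j))
    rw [hB, div_mul_eq_mul_div, le_div_iff₀ (by positivity)]
    nlinarith [mul_le_mul_of_nonneg_left h2 hδ.le]
  rw [one_div, inv_mul_le_iff₀ (by positivity)]
  by_cases hk₀ : k₀ ∈ s
  · have h1 : tentEnergy h θ {k₀} a ≤
        2 * tentEnergy h θ s a + 2 * tentEnergy h θ (s.erase k₀) a := by
      refine double_integral_le_of_le h (f := fun y => ‖waveSum θ {k₀} a y‖ ^ 2)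
        (g₁ := fun y => ‖waveSum θ s a y‖ ^ 2) (g₂ := fun y => ‖waveSum θ (s.erase k₀) a y‖ ^ 2)
        (by fun_prop) (by fun_prop) (by fun_prop) fun y => ?_
      have : waveSum θ {k₀} a y = waveSum θ s a y - waveSum θ (s.erase k₀) a y := by
        rw [waveSum, waveSum, waveSum, ← Finset.add_sum_erase s _ hk₀]
        simp
      rw [this]
      exact norm_sub_sq_le _ _
    rw [tentEnergy_singleton hh.le] at h1
    have h2 := tentEnergy_le_sum (θ := θ) hh.le (s.erase k₀) a
    have h3 := tentEnergy_mono (θ := θ) s a (show h ≤ h + τ by linarith)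
    have h4 : ‖a k₀‖ ^ 2 ≤ B₀ * E := by
      rw [hB₀, div_mul_eq_mul_div, le_div_iff₀ hP]
      nlinarith [mul_le_mul_of_nonneg_left herase hC0]
    rw [← Finset.add_sum_erase s _ hk₀]
    linarith
  · rw [Finset.erase_eq_of_notMem hk₀] at herase
    nlinarith

/-- Adding finitely many wave vectors to an observable family. -/
theorem exists_observable_union {Λ : Set (Fin n → ℤ)} (E : Finset (Fin n → ℤ)) {h h' δ : ℝ}
    (hh : 0 < h) (hhh : h < h') (hδ : 0 < δ)
    (hobs : ∀ (s : Finset (Fin n → ℤ)) (a : (Fin n → ℤ) → ℂ), (∀ k ∈ s, k ∈ Λ) →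
      δ * ∑ k ∈ s, ‖a k‖ ^ 2 ≤ tentEnergy h θ s a) :
    ∃ δ' > 0, ∀ (s : Finset (Fin n → ℤ)) (a : (Fin n → ℤ) → ℂ),
      (∀ k ∈ s, k ∈ (E : Set (Fin n → ℤ)) ∪ Λ) →
      δ' * ∑ k ∈ s, ‖a k‖ ^ 2 ≤ tentEnergy h' θ s a := by
  induction E using Finset.induction_on generalizing h' with
  | empty =>
    refine ⟨δ, hδ, fun s a hs => (hobs s a fun k hk => ?_).trans (tentEnergy_mono s a hhh.le)⟩
    simpa using hs k hk
  | insert k₀ E _ ih =>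
    obtain ⟨δ₁, hδ₁, h₁⟩ := ih (h' := (h + h') / 2) (by linarith)
    obtain ⟨δ₂, hδ₂, h₂⟩ := exists_observable_insert (by linarith) (by linarith : (h + h') / 2 < h')
      hδ₁ h₁ k₀
    refine ⟨δ₂, hδ₂, fun s a hs => h₂ s a fun k hk => ?_⟩
    have := hs k hk
    rwa [Finset.coe_insert, Set.insert_union] at this

end

section

variable {n : ℕ}

def ratVec (m : Fin n → ℤ) : Fin n → ℚ := fun j => m j

theorem ratVec_sub (k l : Fin n → ℤ) : ratVec (k - l) = ratVec k - ratVec l := by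
  ext j; simp [ratVec]

/-- The frequency `|k|² + c·k` of the Galilean-boosted Schrödinger flow. -/
def boostedFreq (c k : Fin n → ℤ) : ℤ := ∑ j, k j ^ 2 + c ⬝ᵥ k

theorem boostedFreq_sub (c k l : Fin n → ℤ) :
    boostedFreq c k - boostedFreq c l = ∑ j, k j ^ 2 - ∑ j, l j ^ 2 + c ⬝ᵥ (k - l) := by
  rw [boostedFreq, boostedFreq, dotProduct_sub]; ring

theorem boostedFreq_add_sub_add (c k l z : Fin n → ℤ) :
    boostedFreq c (k + z) - boostedFreq c (l + z) =
      boostedFreq (c + 2 • z) k - boostedFreq (c + 2 • z) l := by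
  simp only [boostedFreq_sub, add_sub_add_right_eq_sub, dotProduct, ← Finset.sum_sub_distrib,
    ← Finset.sum_add_distrib]
  refine Finset.sum_congr rfl fun j _ => ?_
  simp only [two_nsmul, Pi.add_apply, Pi.sub_apply]
  ring

open Classical in
/-- The observation kernel restricted to differences lying in the rational subspace `F`. -/
noncomputable def boostedKernel (h : ℝ) (F : Submodule ℚ (Fin n → ℚ)) (c k l : Fin n → ℤ) : ℂ :=
  if ratVec (k - l) ∈ F then
    tentProd h (k - l) * tentFT h ((boostedFreq c l - boostedFreq c k : ℤ) : ℝ) else 0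

theorem norm_boostedKernel_le {h : ℝ} (hh : 0 ≤ h) (F : Submodule ℚ (Fin n → ℚ))
    (c k l : Fin n → ℤ) : ‖boostedKernel h F c k l‖ ≤ h ^ 2 * ‖tentProd h (k - l)‖ := by
  rw [boostedKernel]
  split_ifs
  · exact norm_tentProd_mul_tentFT_le hh _ _
  · rw [norm_zero]; positivity

theorem boostedKernel_add_add (h : ℝ) (F : Submodule ℚ (Fin n → ℚ)) (c k l z : Fin n → ℤ) :
    boostedKernel h F c (k + z) (l + z) = boostedKernel h F (c + 2 • z) k l := by
  rw [boostedKernel, boostedKernel, add_sub_add_right_eq_sub, boostedFreq_add_sub_add]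

/-- Coercivity of the observation form on sequences supported in `s`. -/
def IsCoerciveOn (δ h : ℝ) (F : Submodule ℚ (Fin n → ℚ)) (c : Fin n → ℤ)
    (s : Finset (Fin n → ℤ)) : Prop :=
  ∀ a : (Fin n → ℤ) → ℂ, δ * ∑ k ∈ s, ‖a k‖ ^ 2 ≤ (quadForm (boostedKernel h F c) s a).re

theorem IsCoerciveOn.mono {δ δ' h : ℝ} {F : Submodule ℚ (Fin n → ℚ)} {c : Fin n → ℤ}
    {s : Finset (Fin n → ℤ)} (hs : IsCoerciveOn δ h F c s) (hδ : δ' ≤ δ) :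
    IsCoerciveOn δ' h F c s :=
  fun a => (mul_le_mul_of_nonneg_right hδ (by positivity)).trans (hs a)

theorem IsCoerciveOn.of_translate {δ h : ℝ} {F : Submodule ℚ (Fin n → ℚ)} {c : Fin n → ℤ}
    {s : Finset (Fin n → ℤ)} (z : Fin n → ℤ)
    (hs : IsCoerciveOn δ h F (c + 2 • z) (s.image fun k => k - z)) : IsCoerciveOn δ h F c s := by
  intro a
  have h1 := hs fun k => a (k + z)
  have hinj : Set.InjOn (fun k => k - z) (s : Set (Fin n → ℤ)) := sub_left_injective.injOn
  simp_rw [quadForm, Finset.sum_image hinj, ← boostedKernel_add_add, sub_add_cancel] at h1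
  exact h1

/-- Coercivity on single cosets of `F` implies coercivity. -/
theorem isCoerciveOn_of_subset {δ h : ℝ} {F : Submodule ℚ (Fin n → ℚ)}
    (hF : ∀ (c : Fin n → ℤ) (s : Finset (Fin n → ℤ)), (∀ k ∈ s, ratVec k ∈ F) →
      IsCoerciveOn δ h F c s) (c : Fin n → ℤ) (s : Finset (Fin n → ℤ)) :
    IsCoerciveOn δ h F c s := by
  classical
  intro a
  set π : (Fin n → ℤ) → (Fin n → ℚ) ⧸ F := fun k => F.mkQ (ratVec k) with hπ
  have hπeq : ∀ k l, π k = π l ↔ ratVec (k - l) ∈ F := fun k l => by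
    rw [ratVec_sub, hπ]
    exact Submodule.Quotient.eq F
  have hmaps : ∀ k ∈ s, π k ∈ s.image π := fun k hk => Finset.mem_image_of_mem _ hk
  have hQ : quadForm (boostedKernel h F c) s a =
      ∑ q ∈ s.image π, quadForm (boostedKernel h F c) (s.filter fun k => π k = q) a := by
    rw [quadForm, ← Finset.sum_fiberwise_of_maps_to hmaps]
    refine Finset.sum_congr rfl fun q _ => Finset.sum_congr rfl fun k hk => ?_
    rw [Finset.sum_filter]
    refine Finset.sum_congr rfl fun l _ => ?_
    split_ifs with hl
    · rfl
    · have : ¬ ratVec (k - l) ∈ F := fun hkl =>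
        hl (((hπeq k l).2 hkl).symm.trans (Finset.mem_filter.1 hk).2)
      simp [boostedKernel, this]
  rw [hQ, ← Finset.sum_fiberwise_of_maps_to hmaps, Complex.re_sum, Finset.mul_sum]
  refine Finset.sum_le_sum fun q hq => ?_
  obtain ⟨z, hz, rfl⟩ := Finset.mem_image.1 hq
  refine IsCoerciveOn.of_translate z (hF _ _ fun k hk => ?_) a
  obtain ⟨l, hl, rfl⟩ := Finset.mem_image.1 hk
  exact (hπeq l z).1 (Finset.mem_filter.1 hl).2

open Classical in
/-- Short lattice vectors of `F` on which `c` is small, together with the value of `c`. -/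
noncomputable def resonances (D K : ℕ) (F : Submodule ℚ (Fin n → ℚ)) (c : Fin n → ℤ) :
    Finset ((Fin n → ℤ) × ℤ) :=
  ((Fintype.piFinset fun _ => Finset.Ioo (-(2 * D : ℤ)) (2 * D)) ×ˢ
    Finset.Icc (-(K : ℤ)) K).filter fun p => ratVec p.1 ∈ F ∧ c ⬝ᵥ p.1 = p.2

theorem resonances_mem_powerset (D K : ℕ) (F : Submodule ℚ (Fin n → ℚ)) (c : Fin n → ℤ) :
    resonances D K F c ∈ Finset.powerset
      ((Fintype.piFinset fun _ => Finset.Ioo (-(2 * D : ℤ)) (2 * D)) ×ˢ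
        Finset.Icc (-(K : ℤ)) K) := by
  classical exact Finset.mem_powerset.2 (Finset.filter_subset _ _)

def resonantSpan (Γ : Finset ((Fin n → ℤ) × ℤ)) : Submodule ℚ (Fin n → ℚ) :=
  Submodule.span ℚ ((fun p => ratVec p.1) '' (Γ : Set ((Fin n → ℤ) × ℤ)))

theorem resonantSpan_le (D K : ℕ) (F : Submodule ℚ (Fin n → ℚ)) (c : Fin n → ℤ) :
    resonantSpan (resonances D K F c) ≤ F := by
  classical
  refine Submodule.span_le.2 ?_
  rintro _ ⟨p, hp, rfl⟩
  exact (Finset.mem_filter.1 hp).2.1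

theorem dotProduct_eq_of_mem_resonantSpan {Γ : Finset ((Fin n → ℤ) × ℤ)} {c c' : Fin n → ℤ}
    (hΓ : ∀ p ∈ Γ, c ⬝ᵥ p.1 = c' ⬝ᵥ p.1) {m : Fin n → ℤ} (hm : ratVec m ∈ resonantSpan Γ) :
    c ⬝ᵥ m = c' ⬝ᵥ m := by
  have hcast : ∀ d k : Fin n → ℤ, ((d ⬝ᵥ k : ℤ) : ℚ) = ratVec d ⬝ᵥ ratVec k := fun d k => by
    simp [dotProduct, ratVec]
  have key : ∀ x ∈ resonantSpan Γ, ratVec c ⬝ᵥ x = ratVec c' ⬝ᵥ x := fun x hx => by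
    induction hx using Submodule.span_induction with
    | mem x hx =>
      obtain ⟨p, hp, rfl⟩ := hx
      simp only [← hcast]
      rw [hΓ p hp]
    | zero => simp
    | add x y _ _ hx hy => rw [dotProduct_add, dotProduct_add, hx, hy]
    | smul r x _ hx => rw [dotProduct_smul, dotProduct_smul, hx]
  have := key _ hm
  rw [← hcast, ← hcast] at this
  exact_mod_cast this

theorem exists_norm_tentFT_le {h : ℝ} (hh : 0 ≤ h) {η : ℝ} (hη : 0 < η) :
    ∃ L : ℕ, ∀ r : ℝ, (L : ℝ) ≤ |r| → ‖tentFT h r‖ ≤ η := by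
  obtain ⟨L, hL⟩ := exists_nat_ge (4 / η + 1)
  have h4 : 0 < 4 / η := by positivity
  refine ⟨L, fun r hr => ?_⟩
  have h1 := sq_mul_norm_tentFT_le hh r
  have h2 : 4 / η ≤ r ^ 2 := by rw [← sq_abs]; nlinarith
  have h3 : 4 ≤ η * r ^ 2 := by rwa [div_le_iff₀' hη] at h2
  have hr : 0 < r ^ 2 := h4.trans_le h2
  exact le_of_mul_le_mul_left (by linarith) hr

/-- On a bounded window, nonresonant directions contribute negligibly. -/
theorem exists_resonance_cutoff {h ε : ℝ} (hh : 0 ≤ h) (hε : 0 < ε) (D : ℕ) :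
    ∃ K : ℕ, ∀ (F : Submodule ℚ (Fin n → ℚ)) (c : Fin n → ℤ) (s : Finset (Fin n → ℤ)),
      (∀ k ∈ s, ∀ j, |k j| < D) → ∀ a : (Fin n → ℤ) → ℂ,
      ‖quadForm (boostedKernel h F c) s a -
        quadForm (boostedKernel h (resonantSpan (resonances D K F c)) c) s a‖
      ≤ ε * ∑ k ∈ s, ‖a k‖ ^ 2 := by
  set S : ℝ := ∑' m : Fin n → ℤ, ‖tentProd h m‖ with hS
  have hS0 : 0 ≤ S := tsum_nonneg fun _ => norm_nonneg _
  have hη : 0 < ε / (1 + S) := by positivity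
  obtain ⟨L, hL⟩ := exists_norm_tentFT_le hh hη
  refine ⟨L + n * D ^ 2, fun F c s hs a => ?_⟩
  set F' := resonantSpan (resonances D (L + n * D ^ 2) F c) with hF'
  have hdiff : quadForm (boostedKernel h F c) s a - quadForm (boostedKernel h F' c) s a =
      quadForm (fun k l => boostedKernel h F c k l - boostedKernel h F' c k l) s a := by
    simp only [quadForm, ← Finset.sum_sub_distrib, sub_mul]
  rw [hdiff]
  refine (norm_quadForm_le (β := fun m => ε / (1 + S) * ‖tentProd h m‖)
    (fun m => by positivity) ((summable_norm_tentProd hh).mul_left _) _ s a ?_).trans ?_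
  · intro k hk l hl
    by_cases hF'm : ratVec (k - l) ∈ F'
    · have hFm := resonantSpan_le _ _ _ _ hF'm
      simp only [boostedKernel, hF'm, hFm, if_true, sub_self, norm_zero]
      positivity
    by_cases hFm : ratVec (k - l) ∈ F
    swap
    · simp only [boostedKernel, hF'm, hFm, if_false, sub_self, norm_zero]
      positivity
    simp only [boostedKernel, hF'm, hFm, if_true, if_false, sub_zero]
    rw [norm_mul, mul_comm]
    refine mul_le_mul_of_nonneg_right (hL _ ?_) (norm_nonneg _)
    have hbig : ((L + n * D ^ 2 : ℕ) : ℤ) < |c ⬝ᵥ (k - l)| := by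
      by_contra! hle
      refine hF'm (Submodule.subset_span ⟨(k - l, c ⬝ᵥ (k - l)), ?_, rfl⟩)
      simp only [resonances, Finset.coe_filter, Set.mem_ofPred_eq, Finset.mem_product,
        Fintype.mem_piFinset, Finset.mem_Ioo, Finset.mem_Icc, and_true]
      refine ⟨⟨fun j => ?_, abs_le.1 hle⟩, hFm⟩
      have h1 := abs_lt.1 (hs k hk j)
      have h2 := abs_lt.1 (hs l hl j)
      simp only [Pi.sub_apply]
      omega
    have hsq : ∀ k ∈ s, 0 ≤ ∑ j, k j ^ 2 ∧ ∑ j, k j ^ 2 ≤ (n * D ^ 2 : ℤ) := fun k hk => by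
      refine ⟨by positivity, ?_⟩
      refine (Finset.sum_le_sum fun j _ => ?_).trans_eq
        (show ∑ _j : Fin n, (D : ℤ) ^ 2 = n * D ^ 2 by simp)
      exact sq_le_sq' (by linarith [(abs_lt.1 (hs k hk j)).1]) (abs_lt.1 (hs k hk j)).2.le
    have hfi : (L : ℤ) ≤ |boostedFreq c l - boostedFreq c k| := by
      rw [abs_sub_comm, boostedFreq_sub]
      have h1 := hsq k hk
      have h2 := hsq l hl
      push_cast at hbig
      have h3 := abs_sub_abs_le_abs_sub (c ⬝ᵥ (k - l)) (-(∑ j, k j ^ 2 - ∑ j, l j ^ 2))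
      have h4 : |(-(∑ j, k j ^ 2 - ∑ j, l j ^ 2))| ≤ (n * D ^ 2 : ℤ) := by
        rw [abs_le]; constructor <;> linarith [h1.1, h1.2, h2.1, h2.2]
      rw [sub_neg_eq_add, add_comm (c ⬝ᵥ (k - l))] at h3
      linarith
    exact_mod_cast hfi
  · refine mul_le_mul_of_nonneg_right ?_ (by positivity)
    rw [tsum_mul_left, div_mul_eq_mul_div, div_le_iff₀ (by positivity)]
    nlinarith

end

section

variable {n : ℕ}

/-- Coercivity on a sequence all of whose windows are governed by a smaller span. -/
theorem exists_window_coercive {h δ : ℝ} (hh : 0 ≤ h) (hδ : 0 < δ) :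
    ∃ D K : ℕ, ∀ (F : Submodule ℚ (Fin n → ℚ)) (c : Fin n → ℤ) (s : Finset (Fin n → ℤ)),
      (∀ k ∈ s, ∀ s' : Finset (Fin n → ℤ),
        IsCoerciveOn δ h (resonantSpan (resonances D K F (c + 2 • k))) (c + 2 • k) s') →
      IsCoerciveOn (δ / 4) h F c s := by
  obtain ⟨D, hD⟩ := exists_window_size (n := n) (β := fun m => h ^ 2 * ‖tentProd h m‖)
    (fun m => by positivity) ((summable_norm_tentProd hh).mul_left _) (show 0 < δ / 4 by positivity)
  obtain ⟨K, hK⟩ := exists_resonance_cutoff (n := n) hh (show 0 < δ / 2 by positivity) D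
  refine ⟨D, K, fun F c s hs a => ?_⟩
  have h1 := hD (boostedKernel h F c) s a (δ / 2) (norm_boostedKernel_le hh F c) fun z => ?_
  · rwa [show δ / 2 - δ / 4 = δ / 4 by ring] at h1
  set w := s.filter fun k => k - z ∈ cube n D with hw
  rcases w.eq_empty_or_nonempty with h0 | ⟨k₀, hk₀⟩
  · simp [h0, quadForm]
  refine IsCoerciveOn.of_translate k₀ (fun b => ?_) a
  have hbox : ∀ k ∈ w.image fun k => k - k₀, ∀ j, |k j| < D := fun k hk j => by
    obtain ⟨l, hl, rfl⟩ := Finset.mem_image.1 hk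
    have h1 := (Fintype.mem_piFinset.1 (Finset.mem_filter.1 hl).2) j
    have h2 := (Fintype.mem_piFinset.1 (Finset.mem_filter.1 hk₀).2) j
    simp only [Finset.mem_Ico, Pi.sub_apply] at h1 h2
    rw [abs_lt, Pi.sub_apply]
    omega
  have h2 := hK F (c + 2 • k₀) _ hbox b
  have h3 := hs k₀ (Finset.mem_filter.1 hk₀).1 (w.image fun k => k - k₀) b
  have h4 := (abs_le.1 ((Complex.abs_re_le_norm _).trans h2)).1
  rw [Complex.sub_re] at h4
  linarith

theorem quadForm_boostedKernel_eq_tentEnergy (h : ℝ) {F : Submodule ℚ (Fin n → ℚ)}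
    (c : Fin n → ℤ) {s : Finset (Fin n → ℤ)} (hs : ∀ k ∈ s, ratVec k ∈ F)
    (a : (Fin n → ℤ) → ℂ) :
    quadForm (boostedKernel h F c) s a = (tentEnergy h (fun k => boostedFreq c k) s a : ℂ) := by
  rw [ofReal_tentEnergy]
  refine Finset.sum_congr rfl fun k hk => Finset.sum_congr rfl fun l hl => ?_
  have : ratVec (k - l) ∈ F := by
    rw [ratVec_sub]; exact F.sub_mem (hs k hk) (hs l hl)
  rw [boostedKernel, if_pos this]
  push_cast
  rfl

theorem IsCoerciveOn.mono_time {δ h h' : ℝ} {F : Submodule ℚ (Fin n → ℚ)} {c : Fin n → ℤ}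
    {s : Finset (Fin n → ℤ)} (hF : ∀ k ∈ s, ratVec k ∈ F) (hs : IsCoerciveOn δ h F c s)
    (hh : h ≤ h') : IsCoerciveOn δ h' F c s := fun a => by
  have h1 := hs a
  rw [quadForm_boostedKernel_eq_tentEnergy _ _ hF, Complex.ofReal_re] at h1 ⊢
  exact h1.trans (tentEnergy_mono s a hh)

/-- Only finitely many boosts by vectors of `F` are resonant in all directions of `F`. -/
theorem finite_fully_resonant (D K : ℕ) (F : Submodule ℚ (Fin n → ℚ)) (c : Fin n → ℤ) :
    {k : Fin n → ℤ | ratVec k ∈ F ∧ resonantSpan (resonances D K F (c + 2 • k)) = F}.Finite := by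
  classical
  refine Set.Finite.of_finite_image (f := fun k => resonances D K F (c + 2 • k))
    ((Finset.finite_toSet (Finset.powerset _)).subset
      (Set.image_subset_iff.2 fun k _ => resonances_mem_powerset D K F (c + 2 • k))) ?_
  rintro k ⟨hk, hkF⟩ l ⟨hl, -⟩ hkl
  have hm : ratVec (k - l) ∈ resonantSpan (resonances D K F (c + 2 • k)) := by
    rw [hkF, ratVec_sub]; exact F.sub_mem hk hl
  have h1 := dotProduct_eq_of_mem_resonantSpan (c := c + 2 • k) (c' := c + 2 • l)
    (fun p hp => ?_) hm
  · rw [add_dotProduct, add_dotProduct, add_right_inj, smul_dotProduct, smul_dotProduct] at h1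
    have h2 : (k - l) ⬝ᵥ (k - l) = 0 := by
      rw [sub_dotProduct]
      simp only [two_nsmul] at h1
      omega
    exact sub_eq_zero.1 (dotProduct_self_eq_zero.1 h2)
  · have hp' : p ∈ resonances D K F (c + 2 • l) := by
      simpa only [← show resonances D K F (c + 2 • k) = resonances D K F (c + 2 • l) from hkl]
        using hp
    rw [(Finset.mem_filter.1 hp).2.2, (Finset.mem_filter.1 hp').2.2]

/-- Boosts with the same resonances spanning `F` have the same observation form on `F`. -/
theorem IsCoerciveOn.congr_resonances {δ h : ℝ} {F : Submodule ℚ (Fin n → ℚ)} {D K : ℕ}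
    {c c' : Fin n → ℤ} (hc : resonantSpan (resonances D K F c) = F)
    (hcc : resonances D K F c = resonances D K F c') {s : Finset (Fin n → ℤ)}
    (hs : IsCoerciveOn δ h F c s) : IsCoerciveOn δ h F c' s := by
  classical
  have hker : boostedKernel h F c = boostedKernel h F c' := by
    ext k l
    by_cases hkl : ratVec (k - l) ∈ F
    · have hm : ratVec (l - k) ∈ resonantSpan (resonances D K F c) := by
        rw [hc, ratVec_sub, ← neg_sub, ← ratVec_sub]
        exact F.neg_mem hkl
      have h1 := dotProduct_eq_of_mem_resonantSpan (c := c) (c' := c') (fun p hp => by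
        have hp' : p ∈ resonances D K F c' := hcc ▸ hp
        rw [(Finset.mem_filter.1 hp).2.2, (Finset.mem_filter.1 hp').2.2]) hm
      rw [boostedKernel, boostedKernel, boostedFreq_sub, boostedFreq_sub, h1]
    · rw [boostedKernel, boostedKernel, if_neg hkl, if_neg hkl]
  intro a
  rw [← hker]
  exact hs a

/-- Coercivity, uniform in the boost, for all subspaces of dimension less than `r`. -/
theorem exists_coercive (r : ℕ) : ∀ h : ℝ, 0 < h → ∃ δ > 0, ∀ F : Submodule ℚ (Fin n → ℚ),
    Module.finrank ℚ F < r → ∀ (c : Fin n → ℤ) (s : Finset (Fin n → ℤ)),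
      IsCoerciveOn δ h F c s := by
  classical
  induction r with
  | zero => exact fun h _ => ⟨1, one_pos, fun F hF => absurd hF (Nat.not_lt_zero _)⟩
  | succ r ih =>
    intro h' hh'
    obtain ⟨h, hh, hhh⟩ : ∃ h, 0 < h ∧ h < h' := exists_between hh'
    obtain ⟨δ, hδ, hlow⟩ := ih h hh
    obtain ⟨D, K, hDK⟩ := exists_window_coercive (n := n) hh.le hδ
    have hsmall : ∀ F : Submodule ℚ (Fin n → ℚ), Module.finrank ℚ F < r + 1 → ∀ c : Fin n → ℤ,
        ∀ s : Finset (Fin n → ℤ),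
        (∀ k ∈ s, resonantSpan (resonances D K F (c + 2 • k)) ≠ F) →
        IsCoerciveOn (δ / 4) h F c s := fun F hF c s hs =>
      hDK F c s fun k hk s' => hlow _ (lt_of_lt_of_le (Submodule.finrank_lt_finrank_of_lt
        (lt_of_le_of_ne (resonantSpan_le D K F _) (hs k hk))) (Nat.lt_succ_iff.1 hF)) _ s'
    have hsingle : ∀ F : Submodule ℚ (Fin n → ℚ), Module.finrank ℚ F < r + 1 → ∀ c : Fin n → ℤ,
        ∃ δ' > 0, ∀ s : Finset (Fin n → ℤ), (∀ k ∈ s, ratVec k ∈ F) →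
          IsCoerciveOn δ' h' F c s := fun F hF c => by
      have hfin := finite_fully_resonant D K F c
      obtain ⟨δ', hδ', hobs⟩ := exists_observable_union (θ := fun k => (boostedFreq c k : ℝ))
        (Λ := {k | ratVec k ∈ F ∧ resonantSpan (resonances D K F (c + 2 • k)) ≠ F})
        hfin.toFinset hh hhh (show 0 < δ / 4 by positivity) fun s a hs => by
          have h1 := hsmall F hF c s (fun k hk => (hs k hk).2) a
          rwa [quadForm_boostedKernel_eq_tentEnergy _ _ fun k hk => (hs k hk).1,
            Complex.ofReal_re] at h1
      refine ⟨δ', hδ', fun s hs a => ?_⟩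
      rw [quadForm_boostedKernel_eq_tentEnergy _ _ hs, Complex.ofReal_re]
      refine hobs s a fun k hk => ?_
      by_cases hkF : resonantSpan (resonances D K F (c + 2 • k)) = F
      · exact Or.inl (by simpa using ⟨hs k hk, hkF⟩)
      · exact Or.inr ⟨hs k hk, hkF⟩
    have hclass : ∀ Γ : Finset ((Fin n → ℤ) × ℤ), ∃ δ' > 0,
        ∀ (F : Submodule ℚ (Fin n → ℚ)) (c : Fin n → ℤ), Module.finrank ℚ F < r + 1 →
        resonances D K F c = Γ → resonantSpan Γ = F → ∀ s : Finset (Fin n → ℤ),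
        (∀ k ∈ s, ratVec k ∈ F) → IsCoerciveOn δ' h' F c s := fun Γ => by
      by_cases hex : Module.finrank ℚ (resonantSpan Γ) < r + 1 ∧
          ∃ c, resonances D K (resonantSpan Γ) c = Γ
      · obtain ⟨hr, c₀, hc₀⟩ := hex
        obtain ⟨δ', hδ', hobs⟩ := hsingle _ hr c₀
        refine ⟨δ', hδ', ?_⟩
        rintro F c - hc rfl s hs
        exact (hobs s hs).congr_resonances (by rw [hc₀]) (hc₀.trans hc.symm)
      · refine ⟨1, one_pos, ?_⟩
        rintro F c hr hc rfl
        exact absurd ⟨hr, c, hc⟩ hex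
    choose δ' hδ' hclass using hclass
    obtain ⟨κ, hκ, hκle⟩ := exists_pos_forall_le (Finset.powerset
      ((Fintype.piFinset fun _ : Fin n => Finset.Ioo (-(2 * D : ℤ)) (2 * D)) ×ˢ
        Finset.Icc (-(K : ℤ)) K)) δ' fun Γ _ => hδ' Γ
    refine ⟨min κ (δ / 4), lt_min hκ (by positivity), fun F hF =>
      isCoerciveOn_of_subset fun c s hs => ?_⟩
    by_cases hres : ∃ k, ratVec k ∈ F ∧ resonantSpan (resonances D K F (c + 2 • k)) = F
    · obtain ⟨k, hkF, hk⟩ := hres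
      refine IsCoerciveOn.of_translate k ((hclass _ F _ hF rfl hk _ fun l hl => ?_).mono
        ((min_le_left _ _).trans (hκle _ (resonances_mem_powerset D K F _))))
      obtain ⟨m, hm, rfl⟩ := Finset.mem_image.1 hl
      rw [ratVec_sub]
      exact F.sub_mem (hs m hm) hkF
    · push Not at hres
      exact ((hsmall F hF c s fun k hk => hres k (hs k hk)).mono_time hs hhh.le).mono
        (min_le_right _ _)

/-- Observability of the periodic Schrödinger flow from an arbitrarily small space-time cube. -/
theorem exists_le_tentEnergy {h : ℝ} (hh : 0 < h) :
    ∃ δ > 0, ∀ (s : Finset (Fin n → ℤ)) (a : (Fin n → ℤ) → ℂ),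
      δ * ∑ k ∈ s, ‖a k‖ ^ 2 ≤ tentEnergy h (fun k => ∑ j, (k j : ℝ) ^ 2) s a := by
  obtain ⟨δ, hδ, hcoer⟩ := exists_coercive (n := n)
    (Module.finrank ℚ (⊤ : Submodule ℚ (Fin n → ℚ)) + 1) h hh
  refine ⟨δ, hδ, fun s a => ?_⟩
  have h1 := hcoer ⊤ (Nat.lt_succ_self _) 0 s a
  rw [quadForm_boostedKernel_eq_tentEnergy _ _ fun k _ => Submodule.mem_top,
    Complex.ofReal_re] at h1
  simpa [boostedFreq] using h1

end

section

variable {n : ℕ}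

theorem norm_le_of_mem_stBox {h : ℝ} {u : SpaceTime n} (hu : u ∈ stBox n h) : ‖u‖ ≤ h := by
  obtain ⟨⟨h1, h2⟩, h3, h4⟩ := hu
  refine norm_prod_le_iff.2 ⟨by rwa [Real.norm_of_nonneg h1], ?_⟩
  refine (pi_norm_le_iff_of_nonneg (h1.trans h2)).2 fun i => ?_
  rw [Real.norm_of_nonneg (h3 i)]
  exact h4 i

/-- Observability of the periodic Schrödinger flow from a bounded open set. -/
theorem exists_le_setIntegral_waveSum {T : ℝ} (hT : 0 < T) {ω : Set (Fin n → ℝ)} (hω : IsOpen ω)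
    (hne : ω.Nonempty) (hb : Bornology.IsBounded ω) :
    ∃ δ > 0, ∀ (s : Finset (Fin n → ℤ)) (a : (Fin n → ℤ) → ℂ),
      δ * ∑ k ∈ s, ‖a k‖ ^ 2 ≤ ∫ t in Set.Ioc (0 : ℝ) T, ∫ x in ω,
        ‖waveSum (fun k => ∑ j, (k j : ℝ) ^ 2) s a (t, x)‖ ^ 2 := by
  obtain ⟨x₀, hx₀⟩ := hne
  set y₀ : SpaceTime n := (T / 2, x₀) with hy₀
  obtain ⟨ε, hε, hball⟩ := Metric.isOpen_iff.1 (isOpen_Ioo.prod hω) y₀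
    (⟨⟨by positivity, by simpa [hy₀] using hT⟩, hx₀⟩ : y₀ ∈ Set.Ioo 0 T ×ˢ ω)
  have hh : 0 < ε / 4 := by positivity
  obtain ⟨δ, hδ, hobs⟩ := exists_le_tentEnergy (n := n) hh
  set θ : (Fin n → ℤ) → ℝ := fun k => ∑ j, (k j : ℝ) ^ 2
  set V := volume.real (stBox n (ε / 4))
  have hV : 0 ≤ V := measureReal_nonneg
  refine ⟨δ / (V + 1), by positivity, fun s a => ?_⟩
  set f : SpaceTime n → ℝ := fun y => ‖waveSum θ s a y‖ ^ 2 with hf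
  have hc : Continuous f := by fun_prop
  have hf0 : ∀ y, 0 ≤ f y := fun y => by positivity
  have hfi : IntegrableOn f (Set.Ioc 0 T ×ˢ ω) :=
    (hc.continuousOn.integrableOn_compact
      (((Metric.isBounded_Ioc 0 T).prod hb).isCompact_closure)).mono_set subset_closure
  have hpre : (fun u : SpaceTime n => u + y₀) ⁻¹' {y | y - y₀ ∈ stBox n (ε / 4 + ε / 4)} =
      stBox n (ε / 4 + ε / 4) := by
    ext u; simp
  have hmp : MeasurePreserving (fun u : SpaceTime n => u + y₀) volume volume :=
    measurePreserving_add_right ((volume : Measure ℝ).prod (volume : Measure (Fin n → ℝ))) y₀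
  have hle : ∫ u in stBox n (ε / 4 + ε / 4), f (u + y₀) ≤
      ∫ t in Set.Ioc (0 : ℝ) T, ∫ x in ω, f (t, x) := by
    conv_lhs => rw [← hpre]
    rw [hmp.setIntegral_preimage_emb (measurableEmbedding_addRight y₀) f]
    refine (setIntegral_mono_set hfi (ae_of_all _ hf0)
      (Filter.Eventually.of_forall fun y hy => ?_)).trans_eq ?_
    · have hy1 : y ∈ Metric.ball y₀ ε := by
        rw [mem_ball_iff_norm]
        linarith [norm_le_of_mem_stBox hy]
      exact ⟨Set.Ioo_subset_Ioc_self (hball hy1).1, (hball hy1).2⟩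
    · rw [Measure.volume_eq_prod] at hfi ⊢
      exact setIntegral_prod f hfi
  have hshift : ∀ u, ‖waveSum θ s (fun k => a k * wave θ k y₀) u‖ ^ 2 = f (u + y₀) := fun u => by
    simp only [hf, waveSum, wave_add, mul_assoc, mul_comm (wave θ _ y₀)]
  have h1 := (hobs s fun k => a k * wave θ k y₀).trans (tentEnergy_le s _ _)
  simp only [hshift, norm_mul, norm_wave, mul_one] at h1
  rw [div_mul_eq_mul_div, div_le_iff₀ (by positivity)]
  have hI : 0 ≤ ∫ t in Set.Ioc (0 : ℝ) T, ∫ x in ω, f (t, x) :=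
    integral_nonneg fun _ => integral_nonneg fun _ => hf0 _
  nlinarith [mul_le_mul_of_nonneg_left hle hV]

/-- The Fourier coefficients of `sin (p x)`, and of its derivative when `i = j`. -/
noncomputable def sineCoeff (j i : Fin n) (m : ℤ) : ℂ :=
  if i = j then (|m| : ℤ) / 2 else (m.sign : ℂ) / (2 * Complex.I)

/-- The tuples obtained from `p` by sign changes. -/
def signChanges (p : Fin n → ℕ+) : Finset (Fin n → ℤ) :=
  Fintype.piFinset fun i => {((p i : ℕ) : ℤ), -((p i : ℕ) : ℤ)}

theorem sum_signChanges_prod {R : Type*} [CommSemiring R] (p : Fin n → ℕ+) (f : Fin n → ℤ → R) :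
    ∑ k ∈ signChanges p, ∏ i, f i (k i) =
      ∏ i, ∑ m ∈ ({((p i : ℕ) : ℤ), -((p i : ℕ) : ℤ)} : Finset ℤ), f i m :=
  (Finset.prod_univ_sum _ _).symm

/-- The tuple of absolute values. -/
def absTuple (k : Fin n → ℤ) : Fin n → ℕ+ := fun i => (k i).natAbs.toPNat'

theorem mem_signChanges {p : Fin n → ℕ+} {k : Fin n → ℤ} (hk : k ∈ signChanges p) (i : Fin n) :
    k i = (p i : ℕ) ∨ k i = -((p i : ℕ) : ℤ) := by
  simpa using Fintype.mem_piFinset.1 hk i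

theorem absTuple_eq {p : Fin n → ℕ+} {k : Fin n → ℤ} (hk : k ∈ signChanges p) :
    absTuple k = p := by
  ext i
  rcases mem_signChanges hk i with h | h <;> simp [absTuple, h]

theorem pairwiseDisjoint_signChanges (S : Set (Fin n → ℕ+)) :
    S.PairwiseDisjoint signChanges := fun _ _ _ _ hpq =>
  Finset.disjoint_left.2 fun _ hp hq => hpq ((absTuple_eq hp).symm.trans (absTuple_eq hq))

theorem sum_sign_pair {M : Type*} [AddCommMonoid M] (q : ℕ+) (f : ℤ → M) :
    ∑ m ∈ ({((q : ℕ) : ℤ), -((q : ℕ) : ℤ)} : Finset ℤ), f m = f (q : ℕ) + f (-((q : ℕ) : ℤ)) :=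
  Finset.sum_pair (by have := q.pos; omega)

theorem sum_sineCoeff_mul_exp (j i : Fin n) (q : ℕ+) (x : ℝ) :
    ∑ m ∈ ({((q : ℕ) : ℤ), -((q : ℕ) : ℤ)} : Finset ℤ),
        sineCoeff j i m * Complex.exp (Complex.I * (m * x : ℝ)) =
      if i = j then (q : ℝ) * (Real.cos (q * x) : ℂ) else (Real.sin (q * x) : ℂ) := by
  have hq : ((q : ℕ) : ℤ).sign = 1 := Int.sign_eq_one_of_pos (by exact_mod_cast q.pos)
  rw [sum_sign_pair]
  have h1 : Complex.I * ((((q : ℕ) : ℤ) : ℝ) * x : ℝ) = (q * x : ℝ) * Complex.I := by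
    push_cast; ring
  have h2 : Complex.I * (((-((q : ℕ) : ℤ) : ℤ) : ℝ) * x : ℝ) = -((q * x : ℝ) : ℂ) * Complex.I := by
    push_cast; ring
  rw [h1, h2]
  split_ifs with hij
  · simp only [sineCoeff, hij, if_true, abs_neg, Nat.abs_cast]
    rw [Complex.ofReal_cos, Complex.cos]
    push_cast
    ring
  · simp only [sineCoeff, hij, if_false, Int.sign_neg, hq]
    rw [Complex.ofReal_sin, Complex.sin]
    field_simp
    rw [Complex.I_sq]
    push_cast
    ring

theorem sum_norm_sineCoeff_sq (j i : Fin n) (q : ℕ+) :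
    ∑ m ∈ ({((q : ℕ) : ℤ), -((q : ℕ) : ℤ)} : Finset ℤ), ‖sineCoeff j i m‖ ^ 2 =
      1 / 2 * if i = j then (q : ℝ) ^ 2 else 1 := by
  have hq : ((q : ℕ) : ℤ).sign = 1 := Int.sign_eq_one_of_pos (by exact_mod_cast q.pos)
  rw [sum_sign_pair]
  split_ifs with hij
  · simp [sineCoeff, hij]
    ring
  · simp [sineCoeff, hij, hq]
    norm_num

noncomputable def waveCoeff (v : (Fin n → ℕ+) →₀ ℂ) (j : Fin n) (k : Fin n → ℤ) : ℂ :=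
  v (absTuple k) * ∏ i, sineCoeff j i (k i)

theorem dV_eq_waveSum (v : (Fin n → ℕ+) →₀ ℂ) (j : Fin n) (x : Fin n → ℝ) (t : ℝ) :
    dV v j x t = waveSum (fun k => ∑ j, (k j : ℝ) ^ 2) (v.support.biUnion signChanges)
      (waveCoeff v j) (t, x) := by
  rw [dV, Finsupp.sum, waveSum, Finset.sum_biUnion (pairwiseDisjoint_signChanges _)]
  refine Finset.sum_congr rfl fun p _ => ?_
  have hprod : ((p j : ℝ) : ℂ) * (Real.cos ((p j : ℝ) * x j) : ℂ) *
      ∏ i ∈ Finset.univ.erase j, (Real.sin ((p i : ℝ) * x i) : ℂ) =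
      ∑ k ∈ signChanges p, ∏ i,
        sineCoeff j i (k i) * Complex.exp (Complex.I * (k i * x i : ℝ)) := by
    rw [sum_signChanges_prod p fun i m =>
      sineCoeff j i m * Complex.exp (Complex.I * (m * x i : ℝ))]
    simp only [sum_sineCoeff_mul_exp]
    rw [← Finset.mul_prod_erase _ _ (Finset.mem_univ j), if_pos rfl]
    congr 1
    exact Finset.prod_congr rfl fun i hi => (if_neg (Finset.ne_of_mem_erase hi)).symm
  rw [mul_assoc, mul_assoc, ← mul_assoc ((p j : ℝ) : ℂ), hprod, Finset.mul_sum]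
  refine Finset.sum_congr rfl fun k hk => ?_
  have hθ : ∑ j, (k j : ℝ) ^ 2 = pnorm2 p := Finset.sum_congr rfl fun i _ => by
    rcases mem_signChanges hk i with h | h <;> simp [h]
  rw [waveCoeff, absTuple_eq hk, Finset.prod_mul_distrib, ← Complex.exp_sum, wave, hθ]
  have hexp : Complex.exp (Complex.I * (∑ i, (k i : ℝ) * x i - pnorm2 p * t : ℝ)) =
      Complex.exp (-Complex.I * (pnorm2 p : ℂ) * (t : ℂ)) *
        Complex.exp (∑ i, Complex.I * (k i * x i : ℝ)) := by
    rw [← Complex.exp_add, ← Finset.mul_sum]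
    congr 1
    push_cast
    ring
  rw [hexp]
  ring

theorem sum_norm_waveCoeff_sq (v : (Fin n → ℕ+) →₀ ℂ) (j : Fin n) :
    ∑ k ∈ v.support.biUnion signChanges, ‖waveCoeff v j k‖ ^ 2 =
      (1 / 2) ^ n * ∑ p ∈ v.support, (p j : ℝ) ^ 2 * ‖v p‖ ^ 2 := by
  rw [Finset.sum_biUnion (pairwiseDisjoint_signChanges _), Finset.mul_sum]
  refine Finset.sum_congr rfl fun p _ => ?_
  have h1 : ∑ k ∈ signChanges p, ∏ i, ‖sineCoeff j i (k i)‖ ^ 2 = (1 / 2) ^ n * (p j : ℝ) ^ 2 := by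
    rw [sum_signChanges_prod p fun i m => ‖sineCoeff j i m‖ ^ 2]
    simp only [sum_norm_sineCoeff_sq, Finset.prod_mul_distrib]
    simp
  rw [← mul_assoc, ← h1, Finset.sum_mul]
  refine Finset.sum_congr rfl fun k hk => ?_
  rw [waveCoeff, absTuple_eq hk, norm_mul, norm_prod, mul_pow, ← Finset.prod_pow, mul_comm]

end

/-- Lemma 1 (internal observability in `H¹₀`): for any nonempty open
`ω ⊆ (0,π)ⁿ` and `T > 0`,
`Σ_p |p|²|v_p|² ≤ c Σ_j ∫₀ᵀ ∫_ω |∂v/∂x_j(x,t)|² dx dt`. -/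
theorem stmt2 (n : ℕ) (hn : 1 ≤ n) (T : ℝ) (hT : 0 < T)
    (ω : Set (Fin n → ℝ)) (hω : IsOpen ω) (hne : ω.Nonempty)
    (hsub : ω ⊆ {x | ∀ i, x i ∈ Set.Ioo 0 Real.pi}) :
    ∃ c : ℝ, 0 < c ∧ ∀ v : (Fin n → ℕ+) →₀ ℂ,
      (v.sum fun p a => pnorm2 p * ‖a‖ ^ 2) ≤
        c * ∑ j : Fin n, ∫ t in Set.Ioc (0 : ℝ) T, ∫ x in ω, ‖dV v j x t‖ ^ 2 := by
  have hb : Bornology.IsBounded ω := (Metric.isBounded_Icc (0 : Fin n → ℝ) fun _ => Real.pi).subset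
    fun x hx => ⟨fun i => (hsub hx i).1.le, fun i => (hsub hx i).2.le⟩
  obtain ⟨δ, hδ, hobs⟩ := exists_le_setIntegral_waveSum hT hω hne hb
  refine ⟨2 ^ n / δ, by positivity, fun v => ?_⟩
  have hsum : (v.sum fun p a => pnorm2 p * ‖a‖ ^ 2) =
      ∑ j, ∑ p ∈ v.support, (p j : ℝ) ^ 2 * ‖v p‖ ^ 2 := by
    rw [Finsupp.sum, Finset.sum_comm]
    simp only [pnorm2, Finset.sum_mul]
  rw [hsum, Finset.mul_sum]
  refine Finset.sum_le_sum fun j _ => ?_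
  have h1 := hobs (v.support.biUnion signChanges) (waveCoeff v j)
  simp only [← dV_eq_waveSum, sum_norm_waveCoeff_sq] at h1
  rw [div_mul_eq_mul_div, le_div_iff₀ hδ]
  refine le_of_eq_of_le ?_ (mul_le_mul_of_nonneg_left h1 (by positivity : (0 : ℝ) ≤ 2 ^ n))
  rw [one_div, inv_pow]
  field_simp
end

section
/- For every integer n ≥ 1 there exists a function θ : ℝ^n → ℝ of class C³ such that θ(x) ≥ 0 for all x ∈ ℝ^n, θ(x) = 0 whenever x₁ ≤ 0, and θ is strictly convex on the set (0,∞)^n ∩ {x : |x| < 1}, where |x| denotes the Euclidean norm. -/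
theorem hasDerivAt_max_zero_pow (n : ℕ) (s : ℝ) :
    HasDerivAt (fun s : ℝ => max s 0 ^ (n + 2)) ((n + 2) * max s 0 ^ (n + 1)) s := by
  have hpow (s : ℝ) : HasDerivAt (fun s : ℝ => s ^ (n + 2)) ((n + 2) * s ^ (n + 1)) s := by
    simpa using hasDerivAt_pow (n + 2) s
  rcases lt_trichotomy s 0 with h | rfl | h
  · rw [max_eq_right h.le]
    refine ((hasDerivAt_const s (0 : ℝ)).congr_deriv (by simp)).congr_of_eventuallyEq ?_
    filter_upwards [eventually_lt_nhds h] with t ht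
    simp [max_eq_right ht.le]
  · have hl : HasDerivWithinAt (fun s : ℝ => max s 0 ^ (n + 2)) 0 (Set.Iic 0) 0 :=
      (hasDerivWithinAt_const (0 : ℝ) _ (0 : ℝ)).congr
        (fun t ht => by simp [max_eq_right (Set.mem_Iic.1 ht)]) (by simp)
    have hr : HasDerivWithinAt (fun s : ℝ => max s 0 ^ (n + 2)) 0 (Set.Ici 0) 0 :=
      ((hpow 0).congr_deriv (by simp)).hasDerivWithinAt.congr
        (fun t ht => by simp [max_eq_left (Set.mem_Ici.1 ht)]) (by simp)
    have h := hl.union hr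
    rw [Set.Iic_union_Ici, hasDerivWithinAt_univ] at h
    simpa using h
  · rw [max_eq_left h.le]
    refine (hpow s).congr_of_eventuallyEq ?_
    filter_upwards [eventually_gt_nhds h] with t ht
    simp [max_eq_left ht.le]

theorem contDiff_max_zero_pow (n : ℕ) : ContDiff ℝ n (fun s : ℝ => max s 0 ^ (n + 1)) := by
  induction n with
  | zero => exact contDiff_zero.2 (by fun_prop)
  | succ n ih =>
    push_cast
    refine contDiff_succ_iff_deriv.2
      ⟨fun s => (hasDerivAt_max_zero_pow n s).differentiableAt, by simp, ?_⟩
    rw [show deriv (fun s : ℝ => max s 0 ^ (n + 1 + 1)) = fun s => ((n : ℝ) + 2) * max s 0 ^ (n + 1)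
      from funext fun s => (hasDerivAt_max_zero_pow n s).deriv]
    exact contDiff_const.mul ih

theorem strictConvexOn_pow_four_mul_two_add_sq :
    StrictConvexOn ℝ (Set.Ioi 0 ×ˢ Set.Ioo (-1) 1)
      (fun p : ℝ × ℝ => p.1 ^ 4 * (2 + p.2 ^ 2)) := by
  have hconv : Convex ℝ (Set.Ioi (0 : ℝ) ×ˢ Set.Ioo (-1 : ℝ) 1) :=
    (convex_Ioi 0).prod (convex_Ioo (-1) 1)
  refine ⟨hconv, ?_⟩
  rintro ⟨s, t⟩ hx ⟨s', t'⟩ hy hne a b ha hb hab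
  obtain ⟨u, rfl⟩ : ∃ u, s' = s + u := ⟨s' - s, by ring⟩
  obtain ⟨v, rfl⟩ : ∃ v, t' = t + v := ⟨t' - t, by ring⟩
  have hφ : StrictConvexOn ℝ (Set.Icc (0 : ℝ) 1)
      (fun τ : ℝ => (s + τ * u) ^ 4 * (2 + (t + τ * v) ^ 2)) := by
    refine strictConvexOn_of_deriv2_pos' (convex_Icc 0 1) (by fun_prop) fun τ hτ => ?_
    have hs (τ : ℝ) : HasDerivAt (fun τ : ℝ => s + τ * u) u τ := by
      simpa using ((hasDerivAt_id τ).mul_const u).const_add s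
    have ht (τ : ℝ) : HasDerivAt (fun τ : ℝ => t + τ * v) v τ := by
      simpa using ((hasDerivAt_id τ).mul_const v).const_add t
    have h1 (τ : ℝ) := ((hs τ).fun_pow 4).fun_mul (((ht τ).fun_pow 2).const_add 2)
    have h2 := ((((hs τ).fun_pow 3).const_mul 4).mul_const u |>.fun_mul
      (((ht τ).fun_pow 2).const_add 2)).fun_add
      (((hs τ).fun_pow 4).fun_mul (((ht τ).const_mul 2).mul_const v))
    have hd : deriv (fun τ : ℝ => (s + τ * u) ^ 4 * (2 + (t + τ * v) ^ 2)) =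
        fun τ => 4 * (s + τ * u) ^ 3 * u * (2 + (t + τ * v) ^ 2) +
          (s + τ * u) ^ 4 * (2 * (t + τ * v) * v) := by
      funext τ
      rw [(h1 τ).deriv]
      norm_num
    rw [Function.iterate_succ, Function.iterate_one, Function.comp_apply, hd, h2.deriv]
    have hmem : (s + τ * u, t + τ * v) ∈ Set.Ioi (0 : ℝ) ×ˢ Set.Ioo (-1 : ℝ) 1 := by
      convert hconv hx hy (sub_nonneg.2 hτ.2) hτ.1 (by ring) using 1
      ext <;> simp <;> ring
    obtain ⟨hS, hT⟩ := hmem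
    simp only [Set.mem_Ioi, Set.mem_Ioo] at hS hT
    generalize s + τ * u = S at hS ⊢
    generalize t + τ * v = T at hT ⊢
    have hT2 : 0 < 24 - 20 * T ^ 2 := by nlinarith [hT.1, hT.2]
    have hpos : 0 < u ^ 2 * (24 - 20 * T ^ 2) + 2 * (v * S + 4 * u * T) ^ 2 := by
      rcases eq_or_ne u 0 with rfl | hu
      · have hv : v ≠ 0 := by
          rintro rfl
          simp at hne
        simp only [zero_mul, mul_zero, add_zero, ne_eq, OfNat.ofNat_ne_zero, not_false_eq_true,
          zero_pow, zero_add]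
        positivity
      · positivity
    have := mul_pos (pow_pos hS 2) hpos
    norm_num
    nlinarith [this]
  have h := hφ.2 (Set.left_mem_Icc.2 zero_le_one) (Set.right_mem_Icc.2 zero_le_one)
    zero_ne_one ha hb hab
  have ea : a = 1 - b := by linarith
  subst ea
  convert h using 1
  · simp only [Prod.smul_mk, Prod.mk_add_mk, smul_eq_mul]
    ring
  · simp

/-- Lemma 2: for every `n ≥ 1` there is a nonnegative `C³` function on `ℝⁿ`
vanishing on the half-space `{x₁ ≤ 0}` and strictly convex on
`(0,∞)ⁿ ∩ B(0,1)` (Euclidean ball). -/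
theorem stmt3 (n : ℕ) (hn : 1 ≤ n) :
    ∃ θ : EuclideanSpace ℝ (Fin n) → ℝ,
      ContDiff ℝ 3 θ ∧
      (∀ x, 0 ≤ θ x) ∧
      (∀ x, x ⟨0, by omega⟩ ≤ 0 → θ x = 0) ∧
      StrictConvexOn ℝ
        ({x : EuclideanSpace ℝ (Fin n) | ∀ i, 0 < x i} ∩ Metric.ball 0 1) θ := by
  have hcoord (i : Fin n) : ContDiff ℝ 3 (fun x : EuclideanSpace ℝ (Fin n) => x i) := by
    fun_prop
  let i₀ : Fin n := ⟨0, by omega⟩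
  have hconv : Convex ℝ ({x : EuclideanSpace ℝ (Fin n) | ∀ i, 0 < x i} ∩ Metric.ball 0 1) := by
    refine Convex.inter ?_ (convex_ball 0 1)
    intro x hx y hy a b ha hb hab i
    exact convex_Ioi (0 : ℝ) (hx i) (hy i) ha hb hab
  refine ⟨fun x => ∑ j, max (x i₀) 0 ^ 4 * (2 + x j ^ 2), ?_, ?_, ?_, hconv, ?_⟩
  · refine ContDiff.sum fun j _ => ContDiff.mul ?_ (contDiff_const.add ((hcoord j).pow 2))
    exact (contDiff_max_zero_pow 3).comp (hcoord i₀)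
  · intro x
    positivity
  · intro x hx
    simp [i₀, max_eq_right hx]
  · intro x hx y hy hne a b ha hb hab
    have hz := hconv hx hy ha.le hb.le hab
    simp only [max_eq_left (hx.1 i₀).le, max_eq_left (hy.1 i₀).le, max_eq_left (hz.1 i₀).le,
      smul_eq_mul, Finset.mul_sum, ← Finset.sum_add_distrib]
    have hmem {w : EuclideanSpace ℝ (Fin n)}
        (hw : w ∈ {x : EuclideanSpace ℝ (Fin n) | ∀ i, 0 < x i} ∩ Metric.ball 0 1) (j : Fin n) :
        (w i₀, w j) ∈ Set.Ioi (0 : ℝ) ×ˢ Set.Ioo (-1 : ℝ) 1 :=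
      ⟨hw.1 i₀, abs_lt.1 ((PiLp.norm_apply_le w j).trans_lt (mem_ball_zero_iff.1 hw.2))⟩
    obtain ⟨k, hk⟩ : ∃ k, x k ≠ y k := by
      by_contra! h
      exact hne (PiLp.ext h)
    refine Finset.sum_lt_sum (fun j _ => ?_) ⟨k, Finset.mem_univ k, ?_⟩
    · exact strictConvexOn_pow_four_mul_two_add_sq.convexOn.2 (hmem hx j) (hmem hy j)
        ha.le hb.le hab
    · exact strictConvexOn_pow_four_mul_two_add_sq.2 (hmem hx k) (hmem hy k)
        (fun h => hk (congrArg Prod.snd h)) ha hb hab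
end
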